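/- arXiv:1502.00609 — 4 statements merged into one kernel-verified Lean document; each statement's English description precedes it below -/
import Mathlib

section
/- Let L = G ∔ I be a complex semisimple Leibniz algebra with G a semisimple Lie algebra. Then the space Φ^0_{G,G} of degree-0 Leibniz 2-cocycles supported on G⊗G with values in G equals the corresponding space of Lie 2-coboundaries B^2(G,G), and dim Φ^0_{G,G} = (dim G)^2 - dim G. -/
namespace LieAlgebra.IsKilling

open Module

variable {K L ι : Type*} [Field K] [LieRing L] [LieAlgebra K L]
  [IsKilling K L] [Fintype ι] [DecidableEq ι]

/-- The basis dual to `b` with respect to the Killing form. -/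
noncomputable def killingDualBasis (b : Module.Basis ι K L) : Module.Basis ι K L :=
  LinearMap.BilinForm.dualBasis (killingForm K L) (killingForm_nondegenerate K L) b

lemma killingDualBasis_repr_apply (b : Module.Basis ι K L) (x : L) (i : ι) :
    (killingDualBasis b).repr x i = killingForm K L x (b i) :=
  LinearMap.BilinForm.dualBasis_repr_apply (killingForm_nondegenerate K L) b x i

lemma repr_eq_killingForm_killingDualBasis (b : Module.Basis ι K L) (x : L) (i : ι) :
    b.repr x i = killingForm K L x (killingDualBasis b i) := by
  have h : killingDualBasis (killingDualBasis b) = b :=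
    LinearMap.BilinForm.dualBasis_dualBasis (killingForm_nondegenerate K L)
      ⟨LieModule.traceForm_comm K L L⟩ b
  rw [← killingDualBasis_repr_apply, h]

/-- The tensor `∑ i, b i ⊗ b' i` of a basis and its Killing dual is invariant. -/
lemma sum_killingDualBasis_invariant {M : Type*} [AddCommGroup M] [Module K M]
    (b : Module.Basis ι K L) (F : L →ₗ[K] L →ₗ[K] M) (x : L) :
    ∑ i, F (b i) ⁅killingDualBasis b i, x⁆ = -∑ i, F ⁅b i, x⁆ (killingDualBasis b i) := by
  have h₁ (i : ι) : F (b i) ⁅killingDualBasis b i, x⁆ =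
      ∑ j, killingForm K L ⁅killingDualBasis b i, x⁆ (b j) • F (b i) (killingDualBasis b j) := by
    conv_lhs => rw [← (killingDualBasis b).sum_repr ⁅killingDualBasis b i, x⁆]
    simp [killingDualBasis_repr_apply]
  have h₂ (i : ι) : F ⁅b i, x⁆ (killingDualBasis b i) =
      ∑ j, killingForm K L ⁅b i, x⁆ (killingDualBasis b j) • F (b j) (killingDualBasis b i) := by
    conv_lhs => rw [← b.sum_repr ⁅b i, x⁆]
    simp [repr_eq_killingForm_killingDualBasis]
  simp_rw [h₁, h₂]
  rw [Finset.sum_comm, ← Finset.sum_neg_distrib]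
  refine Finset.sum_congr rfl fun i _ ↦ ?_
  rw [← Finset.sum_neg_distrib]
  refine Finset.sum_congr rfl fun j _ ↦ ?_
  rw [LieModule.traceForm_apply_lie_apply, ← lie_skew, map_neg, neg_smul,
    LieModule.traceForm_comm]

/-- The Casimir element of the Killing form acts as the identity in the adjoint
representation. -/
lemma sum_lie_lie_killingDualBasis (b : Module.Basis ι K L) (x : L) :
    ∑ i, ⁅b i, ⁅killingDualBasis b i, x⁆⁆ = x := by
  refine LinearMap.ker_eq_bot.mp (killingForm_nondegenerate K L).ker_eq_bot
    (LinearMap.ext fun y ↦ ?_)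
  rw [LieModule.traceForm_apply_apply K L L x y, LinearMap.trace_eq_matrix_trace K b, map_sum,
    LinearMap.sum_apply, Matrix.trace]
  refine Finset.sum_congr rfl fun i _ ↦ ?_
  rw [Matrix.diag_apply, LinearMap.toMatrix_apply, repr_eq_killingForm_killingDualBasis,
    ← lie_skew, map_neg, LinearMap.neg_apply, LieModule.traceForm_apply_lie_apply,
    LieModule.traceForm_apply_lie_apply, ← lie_skew (b i) y, lie_neg, map_neg, neg_neg,
    LieModule.traceForm_comm]
  rfl

end LieAlgebra.IsKilling

namespace LieAlgebra

open Module

variable {K L : Type*} [Field K] [LieRing L] [LieAlgebra K L]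

/-- The condition that `φ` is a Leibniz 2-cocycle of `L` with adjoint coefficients. -/
def IsLeibnizTwoCocycle (φ : L →ₗ[K] L →ₗ[K] L) : Prop :=
  ∀ x y z : L,
    ⁅x, φ y z⁆ - ⁅φ x y, z⁆ + ⁅φ x z, y⁆ + φ x ⁅y, z⁆ - φ ⁅x, y⁆ z + φ ⁅x, z⁆ y = 0

variable (K L) in
/-- The Lie coboundary map from linear endomorphisms of `L` to bilinear maps on `L`. -/
def twoCoboundary : (L →ₗ[K] L) →ₗ[K] L →ₗ[K] L →ₗ[K] L where
  toFun d := LinearMap.mk₂ K (fun x y ↦ ⁅d x, y⁆ + ⁅x, d y⁆ - d ⁅x, y⁆)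
    (by intros; simp only [map_add, add_lie]; abel)
    (by intros; simp [smul_sub])
    (by intros; simp only [map_add, lie_add]; abel)
    (by intros; simp [smul_sub])
  map_add' d e := by
    ext x y
    simp only [LinearMap.mk₂_apply, LinearMap.add_apply, add_lie, lie_add]
    abel
  map_smul' c d := by
    ext x y
    simp [smul_sub]

@[simp]
lemma twoCoboundary_apply (d : L →ₗ[K] L) (x y : L) :
    twoCoboundary K L d x y = ⁅d x, y⁆ + ⁅x, d y⁆ - d ⁅x, y⁆ := rfl

lemma isLeibnizTwoCocycle_twoCoboundary (d : L →ₗ[K] L) :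
    IsLeibnizTwoCocycle (twoCoboundary K L d) := by
  intro x y z
  have h : d ⁅x, ⁅y, z⁆⁆ = d ⁅⁅x, y⁆, z⁆ - d ⁅⁅x, z⁆, y⁆ := by
    rw [leibniz_lie x y z, map_add, ← lie_skew y ⁅x, z⁆, map_neg, sub_eq_add_neg]
  have jac (a b c : L) : ⁅a, ⁅b, c⁆⁆ = ⁅⁅a, b⁆, c⁆ - ⁅⁅a, c⁆, b⁆ := by
    rw [leibniz_lie a b c, ← lie_skew b ⁅a, c⁆, sub_eq_add_neg]
  simp only [twoCoboundary_apply, add_lie, sub_lie, lie_add, lie_sub, h]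
  rw [jac x (d y) z, jac x y (d z), jac (d x) y z]
  abel

/-- A Leibniz 2-cocycle on a centerless Lie algebra is skew-symmetric. -/
lemma IsLeibnizTwoCocycle.skew {φ : L →ₗ[K] L →ₗ[K] L} (hφ : IsLeibnizTwoCocycle φ)
    (hc : center K L = ⊥) (y z : L) : φ y z = -φ z y := by
  rw [eq_neg_iff_add_eq_zero, ← LieSubmodule.mem_bot (R := K) (L := L), ← hc,
    LieModule.mem_maxTrivSubmodule]
  intro x
  have h := congrArg₂ (· + ·) (hφ x y z) (hφ x z y)
  simp only [← lie_skew y z, map_neg] at h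
  rw [lie_add, ← add_zero (0 : L), ← h]
  abel

/-- Whitehead's second lemma for the adjoint representation, for Leibniz cocycles. -/
lemma IsLeibnizTwoCocycle.exists_twoCoboundary_eq [FiniteDimensional K L] [IsKilling K L]
    {φ : L →ₗ[K] L →ₗ[K] L} (hφ : IsLeibnizTwoCocycle φ) :
    ∃ d, twoCoboundary K L d = φ := by
  classical
  have hs := hφ.skew (center_eq_bot K L)
  let b := finBasis K L
  let b' := IsKilling.killingDualBasis b
  let d : L →ₗ[K] L := ∑ i, (ad K L (b i)) ∘ₗ φ (b' i)
  have hd (x : L) : d x = ∑ i, ⁅b i, φ (b' i) x⁆ := by simp [d]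
  refine ⟨d, ?_⟩
  ext x y
  have hinv (u v : L) : ∑ i, ⁅b i, φ ⁅b' i, u⁆ v⁆ = -∑ i, ⁅⁅b i, u⁆, φ (b' i) v⁆ :=
    IsKilling.sum_killingDualBasis_invariant b
      ((LieModule.toEnd K L L : L →ₗ[K] L →ₗ[K] L).compl₂ (φ.flip v)) u
  have hcas := IsKilling.sum_lie_lie_killingDualBasis b (φ x y)
  have hcoc (i : Fin (finrank K L)) : ⁅b i, ⁅b' i, φ x y⁆⁆ =
      ⁅b i, ⁅φ (b' i) x, y⁆⁆ - ⁅b i, ⁅φ (b' i) y, x⁆⁆ - ⁅b i, φ (b' i) ⁅x, y⁆⁆ +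
        ⁅b i, φ ⁅b' i, x⁆ y⁆ - ⁅b i, φ ⁅b' i, y⁆ x⁆ := by
    simp only [← lie_add, ← lie_sub]
    congr 1
    rw [← sub_eq_zero, ← hφ (b' i) x y]
    abel
  rw [twoCoboundary_apply, ← hcas]
  change _ = ∑ i, ⁅b i, ⁅b' i, φ x y⁆⁆
  simp only [hcoc, Finset.sum_add_distrib, Finset.sum_sub_distrib, hinv, hd]
  have hlie (u v : L) : ⁅∑ i, ⁅b i, φ (b' i) u⁆, v⁆ =
      ∑ i, ⁅b i, ⁅φ (b' i) u, v⁆⁆ + ∑ i, ⁅⁅b i, v⁆, φ (b' i) u⁆ := by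
    rw [sum_lie, ← Finset.sum_add_distrib]
    refine Finset.sum_congr rfl fun i _ ↦ ?_
    rw [leibniz_lie (b i), ← lie_skew _ ⁅b i, v⁆]
    abel
  rw [← lie_skew x, hlie, hlie]
  abel

/-- Derivations of a Killing Lie algebra, the cocycles killed by the coboundary, are inner. -/
lemma ker_twoCoboundary [FiniteDimensional K L] [IsKilling K L] :
    LinearMap.ker (twoCoboundary K L) = LinearMap.range (ad K L : L →ₗ[K] L →ₗ[K] L) := by
  ext d
  rw [LinearMap.mem_ker, LinearMap.mem_range]
  constructor
  · intro hd
    let D : LieDerivation K L L :=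
      { d with
        leibniz' := fun x y ↦ by
          have h := LinearMap.congr_fun₂ hd x y
          simp only [twoCoboundary_apply, LinearMap.zero_apply, sub_eq_zero] at h
          change d ⁅x, y⁆ = ⁅x, d y⁆ - ⁅y, d x⁆
          rw [← h, ← lie_skew (d x) y]
          abel }
    obtain ⟨x, hx⟩ := LieDerivation.IsKilling.exists_eq_ad D
    refine ⟨x, LinearMap.ext fun y ↦ ?_⟩
    have h : ⁅x, y⁆ = D y := by rw [← hx, LieDerivation.ad_apply_apply]
    exact h
  · rintro ⟨x, rfl⟩
    ext y z
    simp

lemma finrank_range_twoCoboundary [FiniteDimensional K L] [IsKilling K L] :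
    finrank K (LinearMap.range (twoCoboundary K L)) = finrank K L ^ 2 - finrank K L := by
  have hinj : Function.Injective (ad K L : L →ₗ[K] L →ₗ[K] L) := by
    rw [← LinearMap.ker_eq_bot]
    refine (Submodule.eq_bot_iff _).mpr fun x hx ↦ ?_
    rw [← LieSubmodule.mem_bot (R := K) (L := L), ← center_eq_bot K L,
      LieModule.mem_maxTrivSubmodule]
    intro y
    have h : ⁅x, y⁆ = 0 := LinearMap.congr_fun (LinearMap.mem_ker.mp hx) y
    rw [← lie_skew, h, neg_zero]
  have h := (twoCoboundary K L).finrank_range_add_finrank_ker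
  rw [ker_twoCoboundary, LinearMap.finrank_range_of_inj hinj, finrank_linearMap] at h
  rw [sq, ← h, Nat.add_sub_cancel]

end LieAlgebra

/-- For a complex semisimple Lie algebra `G` (the Lie part of a semisimple Leibniz
algebra `L = G ∔ I`), the space `Φ⁰_{G,G}` of degree-`0` Leibniz 2-cocycles supported
on `G ⊗ G` with values in `G` equals the space `B²(G,G)` of Lie 2-coboundaries, and
`dim Φ⁰_{G,G} = (dim G)² - dim G`. -/
theorem stmt11 {G : Type*} [LieRing G] [LieAlgebra ℂ G] [FiniteDimensional ℂ G]
    [LieAlgebra.IsSemisimple ℂ G] :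
    let Zset : Set (G →ₗ[ℂ] G →ₗ[ℂ] G) := {φ | ∀ x y z : G,
      ⁅x, φ y z⁆ - ⁅φ x y, z⁆ + ⁅φ x z, y⁆ + φ x ⁅y, z⁆ - φ ⁅x, y⁆ z + φ ⁅x, z⁆ y = 0}
    let Bset : Set (G →ₗ[ℂ] G →ₗ[ℂ] G) := {f | ∃ d : G →ₗ[ℂ] G,
      ∀ x y : G, f x y = ⁅d x, y⁆ + ⁅x, d y⁆ - d ⁅x, y⁆}
    Zset = Bset ∧
      Module.finrank ℂ ↥(Submodule.span ℂ Zset) =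
        Module.finrank ℂ G ^ 2 - Module.finrank ℂ G := by
  intro Zset Bset
  have hZ : Zset = LinearMap.range (LieAlgebra.twoCoboundary ℂ G) := by
    ext φ
    constructor
    · exact fun hφ ↦ LieAlgebra.IsLeibnizTwoCocycle.exists_twoCoboundary_eq hφ
    · rintro ⟨d, rfl⟩
      exact LieAlgebra.isLeibnizTwoCocycle_twoCoboundary d
  refine ⟨?_, ?_⟩
  · rw [hZ]
    ext f
    refine exists_congr fun d ↦ ⟨?_, fun h ↦ (LinearMap.ext₂ h).symm⟩
    rintro rfl x y
    rfl
  · rw [hZ, Submodule.span_eq, LieAlgebra.finrank_range_twoCoboundary]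
end

section
/- Let L = G ∔ I be a complex simple Leibniz algebra with G simple Lie algebra, I an irreducible G-module, dim G ≠ dim I. Then every derivation d of L has the form d = R_a + λ·id_I for some a ∈ G and λ ∈ C (i.e., d restricted to G is right multiplication by a composed appropriately and d maps I to I acting as R_a + λ·id). -/
open Module

/-- Every derivation of a finite-dimensional simple Lie algebra over a field of characteristic
zero, given by a bare bilinear bracket, is inner. -/
theorem exists_eq_bracket_of_derivation_of_simple {K V : Type*} [Field K] [CharZero K]
    [AddCommGroup V] [Module K V] [FiniteDimensional K V] (b : V →ₗ[K] V →ₗ[K] V)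
    (alt : ∀ x, b x x = 0)
    (jac : ∀ x y z, b x (b y z) = b (b x y) z + b y (b x z))
    (simple : ∀ J : Submodule K V, (∀ g, ∀ a ∈ J, b g a ∈ J) → J = ⊥ ∨ J = ⊤)
    (nonab : ∃ x y, b x y ≠ 0)
    (δ : V →ₗ[K] V) (hδ : ∀ x y, δ (b x y) = b (δ x) y + b x (δ y)) :
    ∃ a, ∀ x, δ x = b a x := by
  let : LieRing V :=
    { bracket := fun x y ↦ b x y
      add_lie := fun x y z ↦ by change b (x + y) z = b x z + b y z; simp
      lie_add := fun x y z ↦ by change b x (y + z) = b x y + b x z; simp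
      lie_self := alt
      leibniz_lie := jac }
  let : LieAlgebra K V := { lie_smul := fun t x y ↦ (b x).map_smul t y }
  have : LieAlgebra.IsSimple K V :=
    { eq_bot_or_eq_top := fun J ↦ by
        have := simple J.toSubmodule fun g a ha ↦ J.lie_mem (x := g) ha
        simpa using this
      non_abelian := fun h ↦ by
        obtain ⟨x, y, hxy⟩ := nonab
        exact hxy (h.trivial x y) }
  obtain ⟨a, ha⟩ := LieDerivation.IsKilling.exists_eq_ad (R := K) (L := V)
    { toLinearMap := δ
      leibniz' := fun x y ↦ by
        rw [← lie_skew y (δ x), sub_neg_eq_add, add_comm]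
        exact hδ x y }
  exact ⟨a, fun x ↦ (DFunLike.congr_fun ha x).symm.trans
    (LieDerivation.ad_apply_apply K V a x)⟩


/-- Derivations of a complex simple Leibniz algebra `L = G ∔ I` with `dim G ≠ dim I`:
every derivation `d` of `L` has the form `d = R_a + λ·id_I` for some `a ∈ G`,
`λ ∈ ℂ`. -/
theorem stmt13 {L : Type*} [AddCommGroup L] [Module ℂ L] [FiniteDimensional ℂ L]
    (br : L →ₗ[ℂ] L →ₗ[ℂ] L)
    (leib : ∀ x y z : L, br x (br y z) = br (br x y) z - br (br x z) y)
    (G I : Submodule ℂ L) (hcompl : IsCompl G I)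
    (hGG : ∀ a ∈ G, ∀ b ∈ G, br a b ∈ G)
    (hIG : ∀ a ∈ I, ∀ b ∈ G, br a b ∈ I)
    -- `[G,I] = 0` and `[I,I] = 0`
    (hGI : ∀ a ∈ G, ∀ b ∈ I, br a b = 0)
    (hII : ∀ a ∈ I, ∀ b ∈ I, br a b = 0)
    -- `G` is a simple (non-abelian) Lie algebra
    (hGlie : ∀ a ∈ G, br a a = 0)
    (hGsimple : ∀ J : Submodule ℂ L, J ≤ G →
      (∀ a ∈ J, ∀ g ∈ G, br a g ∈ J ∧ br g a ∈ J) → J = ⊥ ∨ J = G)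
    (hGnonab : ∃ a ∈ G, ∃ b ∈ G, br a b ≠ 0)
    -- `I` is an irreducible (nonzero) right `G`-module
    (hIirr : ∀ J : Submodule ℂ L, J ≤ I →
      (∀ a ∈ J, ∀ g ∈ G, br a g ∈ J) → J = ⊥ ∨ J = I)
    (hIne : I ≠ ⊥)
    -- `dim G ≠ dim I`
    (hdim : Module.finrank ℂ ↥G ≠ Module.finrank ℂ ↥I)
    (d : L →ₗ[ℂ] L)
    (hd : ∀ x y : L, d (br x y) = br (d x) y + br x (d y)) :
    ∃ a ∈ G, ∃ lam : ℂ,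
      (∀ x ∈ G, d x = br x a) ∧ ∀ x ∈ I, d x = br x a + lam • x := by
  have skew : ∀ x ∈ G, ∀ y ∈ G, br x y = - br y x := fun x hx y hy ↦ by
    have h := hGlie (x + y) (G.add_mem hx hy)
    simp only [map_add, LinearMap.add_apply, hGlie x hx, hGlie y hy] at h
    rw [eq_neg_iff_add_eq_zero]
    simpa [add_comm] using h
  have decomp : ∀ z : L, ∃ u ∈ G, ∃ v ∈ I, u + v = z := fun z ↦
    Submodule.mem_sup.mp (hcompl.sup_eq_top ▸ Submodule.mem_top)
  have brI : ∀ z, ∀ y ∈ I, br z y = 0 := fun z y hy ↦ by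
    obtain ⟨u, hu, v, hv, rfl⟩ := decomp z
    simp [hGI u hu y hy, hII v hv y hy]
  -- the center of `G` is trivial
  have center : ∀ c ∈ G, (∀ g ∈ G, br g c = 0) → c = 0 := fun c hc h ↦ by
    let Z : Submodule ℂ L := G ⊓ ⨅ g : G, LinearMap.ker (br g)
    have memZ : ∀ z, z ∈ Z ↔ z ∈ G ∧ ∀ g ∈ G, br g z = 0 := by simp [Z]
    rcases hGsimple Z inf_le_left fun z hz g hg ↦ by
      have h1 := ((memZ z).mp hz).2 g hg
      have h2 := skew z ((memZ z).mp hz).1 g hg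
      simp [h1, h2] with hZ | hZ
    · exact (Submodule.mem_bot ℂ).mp (hZ ▸ (memZ c).mpr ⟨hc, h⟩)
    · obtain ⟨x, hx, y, hy, hxy⟩ := hGnonab
      exact absurd (((memZ y).mp (hZ ▸ hy)).2 x hx) hxy
  have dI : ∀ x ∈ I, d x ∈ I := fun x hx ↦ by
    obtain ⟨u, hu, v, hv, huv⟩ := decomp (d x)
    have : u = 0 := center u hu fun g hg ↦ by
      have h := hd g x
      rw [hGI g hg x hx, map_zero, brI _ x hx, zero_add, ← huv, map_add, hGI g hg v hv,
        add_zero] at h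
      exact h.symm
    rw [← huv, this, zero_add]
    exact hv
  let ψ : L →ₗ[ℂ] L := I.projection G hcompl.symm ∘ₗ d
  have dG : ∀ x ∈ G, d x ∈ G := by
    have ψ_mem : ∀ x, ψ x ∈ I := fun x ↦ by simp [ψ]
    have ψ_br : ∀ x ∈ G, ∀ y ∈ G, ψ (br x y) = br (ψ x) y := fun x hx y hy ↦ by
      obtain ⟨u, hu, v, hv, huv⟩ := decomp (d x)
      obtain ⟨u', hu', v', hv', huv'⟩ := decomp (d y)
      have key : ∀ p ∈ G, ∀ q ∈ I, I.projection G hcompl.symm (p + q) = q := fun p hp q hq ↦ by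
        rw [map_add, (Submodule.projection_apply_eq_zero_iff hcompl.symm).mpr hp, zero_add]
        exact Submodule.projection_apply_left hcompl.symm ⟨q, hq⟩
      have h1 : ψ x = v := by simp only [ψ, LinearMap.comp_apply, ← huv]; exact key u hu v hv
      have h2 : d (br x y) = (br u y + br x u') + br v y := by
        rw [hd, ← huv, ← huv']
        simp only [map_add, LinearMap.add_apply, hGI x hx v' hv']
        abel
      simp only [h1, ψ, LinearMap.comp_apply]
      rw [h2]
      exact key _ (G.add_mem (hGG u hu y hy) (hGG x hx u' hu')) _ (hIG v hv y hy)
    rcases hGsimple (G ⊓ LinearMap.ker ψ) inf_le_left fun x hx g hg ↦ by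
      have h1 : br x g ∈ G ⊓ LinearMap.ker ψ :=
        ⟨hGG x hx.1 g hg, by
          change ψ (br x g) = 0
          rw [ψ_br x hx.1 g hg, LinearMap.mem_ker.mp hx.2, map_zero, LinearMap.zero_apply]⟩
      exact ⟨h1, skew g hg x hx.1 ▸ Submodule.neg_mem _ h1⟩ with hk | hk
    · -- `ψ` is injective on `G`, hence an isomorphism onto `I`
      exfalso
      have hinj : Function.Injective (ψ.domRestrict G) := by
        rw [← LinearMap.ker_eq_bot, LinearMap.ker_eq_bot']
        exact fun x hx ↦ Subtype.ext ((Submodule.mem_bot ℂ).mp (hk ▸ ⟨x.2, hx⟩))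
      have hrank : finrank ℂ (G.map ψ) = finrank ℂ G := by
        rw [← LinearMap.range_domRestrict, LinearMap.finrank_range_of_inj hinj]
      rcases hIirr (G.map ψ) (by rintro _ ⟨x, -, rfl⟩; exact ψ_mem x) (by
        rintro _ ⟨x, hx, rfl⟩ g hg
        exact ⟨br x g, hGG x hx g hg, ψ_br x hx g hg⟩) with h | h
      · obtain ⟨x, hx, y, -, hxy⟩ := hGnonab
        have hx0 : x ∈ G ⊓ LinearMap.ker ψ :=
          ⟨hx, (Submodule.mem_bot ℂ).mp (h ▸ Submodule.mem_map_of_mem hx)⟩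
        rw [hk, Submodule.mem_bot] at hx0
        simp [hx0] at hxy
      · exact hdim (by rw [← hrank, h])
    · intro x hx
      have : x ∈ LinearMap.ker ψ := (hk.ge hx).2
      exact (Submodule.projection_apply_eq_zero_iff hcompl.symm).mp this
  obtain ⟨a, haG, ha⟩ : ∃ a ∈ G, ∀ x ∈ G, d x = br x a := by
    let b : G →ₗ[ℂ] G →ₗ[ℂ] G :=
      LinearMap.mk₂ ℂ (fun x y ↦ ⟨br x y, hGG x x.2 y y.2⟩)
        (fun _ _ _ ↦ Subtype.ext (by simp)) (fun _ _ _ ↦ Subtype.ext (by simp))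
        (fun _ _ _ ↦ Subtype.ext (by simp)) (fun _ _ _ ↦ Subtype.ext (by simp))
    have b_coe : ∀ x y : G, (b x y : L) = br x y := fun _ _ ↦ rfl
    obtain ⟨c, hc⟩ := exists_eq_bracket_of_derivation_of_simple b
      (fun x ↦ Subtype.ext (hGlie x x.2))
      (fun x y z ↦ Subtype.ext (by
        simp only [b_coe, Submodule.coe_add]
        rw [leib, skew y y.2 _ (hGG x x.2 z z.2), sub_eq_add_neg]))
      (fun J hJ ↦ by
        rcases hGsimple (J.map G.subtype) (Submodule.map_subtype_le G J) (by
          rintro _ ⟨x, hx, rfl⟩ g hg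
          have h1 : br g x ∈ J.map G.subtype := ⟨b ⟨g, hg⟩ x, hJ _ x hx, rfl⟩
          exact ⟨skew x x.2 g hg ▸ Submodule.neg_mem _ h1, h1⟩) with h | h
        · exact .inl (Submodule.map_injective_of_injective G.injective_subtype
            (h.trans (Submodule.map_bot _).symm))
        · refine .inr (eq_top_iff.mpr fun x _ ↦ ?_)
          obtain ⟨y, hy, hyx⟩ := h.ge x.2
          exact (Subtype.ext hyx : y = x) ▸ hy)
      (by
        obtain ⟨x, hx, y, hy, hxy⟩ := hGnonab
        exact ⟨⟨x, hx⟩, ⟨y, hy⟩, fun h ↦ hxy (congrArg Subtype.val h)⟩)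
      (d.restrict dG) (fun x y ↦ Subtype.ext (hd x y))
    refine ⟨-c, G.neg_mem c.2, fun x hx ↦ ?_⟩
    rw [map_neg, skew x hx c c.2, neg_neg]
    exact congrArg Subtype.val (hc ⟨x, hx⟩)
  let T : L →ₗ[ℂ] L := d - br.flip a
  have T_apply : ∀ x, T x = d x - br x a := fun _ ↦ rfl
  have T_mem : ∀ x ∈ I, T x ∈ I := fun x hx ↦ I.sub_mem (dI x hx) (hIG x hx a haG)
  have T_br : ∀ x, ∀ g ∈ G, T (br x g) = br (T x) g := fun x g hg ↦ by
    simp only [T_apply, hd, ha g hg, leib x g a, map_sub, LinearMap.sub_apply]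
    abel
  have : Nontrivial I := Submodule.nontrivial_iff_ne_bot.mpr hIne
  obtain ⟨lam, hlam⟩ := Module.End.exists_eigenvalue (T.restrict T_mem)
  obtain ⟨v, hv⟩ := hlam.exists_hasEigenvector
  have hE : I ⊓ LinearMap.ker (T - lam • LinearMap.id) = I :=
    (hIirr _ inf_le_left fun x hx g hg ↦ ⟨hIG x hx.1 g hg, by
      have h := sub_eq_zero.mp (LinearMap.mem_ker.mp hx.2)
      simp only [LinearMap.smul_apply, LinearMap.id_apply] at h
      simp [T_br x g hg, h]⟩).resolve_left fun h ↦ hv.2 (Subtype.ext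
        ((Submodule.mem_bot ℂ).mp (h ▸ ⟨v.2, by
          have := congrArg Subtype.val hv.apply_eq_smul
          simpa [sub_eq_zero] using this⟩)))
  refine ⟨a, haG, lam, ha, fun x hx ↦ ?_⟩
  have h : x ∈ LinearMap.ker (T - lam • LinearMap.id) := (hE.symm ▸ hx : x ∈ I ⊓ _).2
  have h' : d x - br x a - lam • x = 0 := h
  rw [sub_sub, sub_eq_zero] at h'
  exact h'
end

section
/- Let L = G ∔ I be a complex simple Leibniz algebra with G simple and I irreducible, dim G ≠ dim I. Then the space of Leibniz 2-coboundaries BL^2(L,L) has dimension (dim G + dim I)^2 - dim G - 1. -/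
/-- Two irreducible families of operators on spaces of different dimensions admit no nonzero
intertwiner. -/
theorem intertwiner_eq_zero_of_finrank_ne {K ι M N : Type*} [Field K] [AddCommGroup M] [Module K M]
    [AddCommGroup N] [Module K N] (ρ : ι → Module.End K M) (σ : ι → Module.End K N)
    (hM : ∀ J : Submodule K M, (∀ m ∈ J, ∀ g, ρ g m ∈ J) → J = ⊥ ∨ J = ⊤)
    (hN : ∀ J : Submodule K N, (∀ n ∈ J, ∀ g, σ g n ∈ J) → J = ⊥ ∨ J = ⊤)
    (hdim : Module.finrank K M ≠ Module.finrank K N)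
    (φ : M →ₗ[K] N) (hφ : ∀ g m, φ (ρ g m) = σ g (φ m)) : φ = 0 := by
  rcases hM (LinearMap.ker φ) (fun m hm g ↦ by
    rw [LinearMap.mem_ker] at hm ⊢; rw [hφ, hm, map_zero]) with hk | hk
  · rcases hN (LinearMap.range φ) (by
      rintro _ ⟨m, rfl⟩ g
      exact ⟨ρ g m, hφ g m⟩) with hr | hr
    · exact LinearMap.range_eq_bot.mp hr
    · exact absurd (LinearEquiv.ofBijective φ
        ⟨LinearMap.ker_eq_bot.mp hk, LinearMap.range_eq_top.mp hr⟩).finrank_eq hdim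
  · exact LinearMap.ker_eq_top.mp hk

/-- Schur's lemma: an operator commuting with an irreducible family is a scalar. -/
theorem exists_eq_smul_of_commute_irreducible {K ι M : Type*} [Field K] [IsAlgClosed K]
    [AddCommGroup M] [Module K M] [FiniteDimensional K M] [Nontrivial M] (ρ : ι → Module.End K M)
    (hM : ∀ J : Submodule K M, (∀ m ∈ J, ∀ g, ρ g m ∈ J) → J = ⊥ ∨ J = ⊤)
    (T : Module.End K M) (hT : ∀ g m, T (ρ g m) = ρ g (T m)) : ∃ c : K, ∀ m, T m = c • m := by
  obtain ⟨c, hc⟩ := Module.End.exists_eigenvalue T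
  refine ⟨c, fun m ↦ ?_⟩
  rcases hM (T.eigenspace c) (fun m hm g ↦ by
    rw [Module.End.mem_eigenspace_iff] at hm ⊢; rw [hT, hm, map_smul]) with h | h
  · exact absurd h hc
  · exact Module.End.mem_eigenspace_iff.mp (h ▸ Submodule.mem_top)

/-- Every derivation of a finite-dimensional simple Lie algebra over a field of characteristic zero
is inner, for a Lie algebra presented by its bilinear bracket. -/
theorem exists_inner_of_simple {K g : Type*} [Field K] [CharZero K] [AddCommGroup g] [Module K g]
    [FiniteDimensional K g] (b : g →ₗ[K] g →ₗ[K] g) (alt : ∀ x, b x x = 0)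
    (leib : ∀ x y z, b x (b y z) = b (b x y) z - b (b x z) y)
    (simple : ∀ J : Submodule K g, (∀ a ∈ J, ∀ x, b a x ∈ J) → J = ⊥ ∨ J = ⊤)
    (nonab : ∃ x y, b x y ≠ 0)
    (D : g →ₗ[K] g) (hD : ∀ x y, D (b x y) = b (D x) y + b x (D y)) :
    ∃ a, ∀ x, D x = b x a := by
  have skew : ∀ x y, b x y = -b y x := fun x y ↦ by
    have h := alt (x + y)
    simp only [map_add, LinearMap.add_apply, alt, zero_add, add_zero] at h
    exact eq_neg_of_add_eq_zero_right h
  let _ : LieRing g :=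
    { bracket := fun x y ↦ b x y
      add_lie := fun x y z ↦ by simp
      lie_add := fun x y z ↦ by simp
      lie_self := alt
      leibniz_lie := fun x y z ↦ by
        change b x (b y z) = b (b x y) z + b y (b x z)
        rw [leib, skew y, sub_eq_add_neg] }
  let _ : LieAlgebra K g :=
    { lie_smul := fun c x y ↦ (b x).map_smul c y }
  have hbr : ∀ x y : g, ⁅x, y⁆ = b x y := fun _ _ ↦ rfl
  have : LieAlgebra.IsSimple K g :=
    { eq_bot_or_eq_top := fun J ↦ by
        rcases simple J.toSubmodule (fun a ha x ↦ by
          rw [skew]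
          exact neg_mem (J.lie_mem ha)) with h | h
        · exact Or.inl ((LieSubmodule.toSubmodule_eq_bot J).mp h)
        · exact Or.inr ((LieSubmodule.toSubmodule_eq_top J).mp h)
      non_abelian := fun h ↦ by
        obtain ⟨x, y, hxy⟩ := nonab
        exact hxy (h.trivial x y) }
  let D' : LieDerivation K g g :=
    { D with
      leibniz' := fun x y ↦ by
        change D (b x y) = b x (D y) - b y (D x)
        rw [hD, skew y, sub_neg_eq_add, add_comm] }
  obtain ⟨a, ha⟩ := LieDerivation.IsKilling.exists_eq_ad D'
  refine ⟨-a, fun x ↦ ?_⟩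
  have h : LieDerivation.ad K g a x = D x := by rw [ha]; rfl
  rw [← h, LieDerivation.ad_apply_apply, hbr, map_neg, skew]

/-- The Leibniz 2-coboundary `(x, y) ↦ [d x, y] + [x, d y] - d [x, y]` of a linear map `d`,
as a linear function of `d`. -/
def leibnizCoboundary {K L : Type*} [CommRing K] [AddCommGroup L] [Module K L]
    (br : L →ₗ[K] L →ₗ[K] L) : (L →ₗ[K] L) →ₗ[K] (L →ₗ[K] L →ₗ[K] L) where
  toFun d := br ∘ₗ d + br.compl₂ d - br.compr₂ d
  map_add' d e := by ext x y; simp; abel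
  map_smul' c d := by ext x y; simp [smul_add, smul_sub]

theorem leibnizCoboundary_apply {K L : Type*} [CommRing K] [AddCommGroup L] [Module K L]
    (br : L →ₗ[K] L →ₗ[K] L) (d : L →ₗ[K] L) (x y : L) :
    leibnizCoboundary br d x y = br (d x) y + br x (d y) - d (br x y) := rfl

/-- The linear map `(a, c) ↦ R_a + c P`, where `R_a` is right multiplication by `a ∈ G`. -/
def rightMulAddSMul {K L : Type*} [CommRing K] [AddCommGroup L] [Module K L]
    (br : L →ₗ[K] L →ₗ[K] L) (G : Submodule K L) (P : L →ₗ[K] L) :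
    (G × K) →ₗ[K] (L →ₗ[K] L) :=
  (br.flip ∘ₗ G.subtype).coprod (LinearMap.toSpanSingleton K (L →ₗ[K] L) P)

theorem rightMulAddSMul_apply {K L : Type*} [CommRing K] [AddCommGroup L] [Module K L]
    (br : L →ₗ[K] L →ₗ[K] L) (G : Submodule K L) (P : L →ₗ[K] L) (p : G × K) (u : L) :
    rightMulAddSMul br G P p u = br u p.1 + p.2 • P u := by
  simp [rightMulAddSMul]

/-- Derivations of a simple Leibniz algebra `G ∔ I` with `dim G ≠ dim I` are of the form
`R_a + c • id_I` with `a ∈ G`. -/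
theorem exists_derivation_eq {K L : Type*} [Field K] [CharZero K] [IsAlgClosed K]
    [AddCommGroup L] [Module K L] [FiniteDimensional K L]
    (br : L →ₗ[K] L →ₗ[K] L)
    (leib : ∀ x y z : L, br x (br y z) = br (br x y) z - br (br x z) y)
    (G I : Submodule K L) (hcompl : IsCompl G I)
    (hGG : ∀ a ∈ G, ∀ b ∈ G, br a b ∈ G)
    (hIG : ∀ a ∈ I, ∀ b ∈ G, br a b ∈ I)
    (hI : ∀ a, ∀ b ∈ I, br a b = 0)
    (hGlie : ∀ a ∈ G, br a a = 0)
    (hGsimple : ∀ J : Submodule K L, J ≤ G → (∀ a ∈ J, ∀ g ∈ G, br a g ∈ J) → J = ⊥ ∨ J = G)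
    (hGnonab : ∃ a ∈ G, ∃ b ∈ G, br a b ≠ 0)
    (hIirr : ∀ J : Submodule K L, J ≤ I → (∀ a ∈ J, ∀ g ∈ G, br a g ∈ J) → J = ⊥ ∨ J = I)
    (hIne : I ≠ ⊥) (hdim : Module.finrank K G ≠ Module.finrank K I)
    (d : L →ₗ[K] L) (hd : ∀ x y, d (br x y) = br (d x) y + br x (d y)) :
    ∃ a ∈ G, ∃ c : K, ∀ u, d u = br u a + c • (I.projectionOnto G hcompl.symm u : L) := by
  have irr : ∀ {S : Submodule K L} (hS : ∀ a ∈ S, ∀ b ∈ G, br a b ∈ S),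
      (∀ J : Submodule K L, J ≤ S → (∀ a ∈ J, ∀ g ∈ G, br a g ∈ J) → J = ⊥ ∨ J = S) →
      ∀ J : Submodule K S, (∀ m ∈ J, ∀ g : G, (br.flip g).restrict (fun a ha ↦ hS a ha g g.2) m ∈ J)
        → J = ⊥ ∨ J = ⊤ := by
    intro S hS h J hJ
    have h' := h (J.map S.subtype) (Submodule.map_subtype_le S J) (by
      rintro _ ⟨m, hm, rfl⟩ g hg
      exact ⟨_, hJ m hm ⟨g, hg⟩, rfl⟩)
    refine h'.imp (fun h ↦ ?_) (fun h ↦ ?_) <;>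
      apply Submodule.map_injective_of_injective S.injective_subtype
    · rw [h, Submodule.map_bot]
    · rw [h, Submodule.map_subtype_top]
  have irrG := irr hGG hGsimple
  have irrI := irr hIG hIirr
  set ρ : G → Module.End K G := fun g ↦ (br.flip g).restrict (fun a ha ↦ hGG a ha g g.2)
  set σ : G → Module.End K I := fun g ↦ (br.flip g).restrict (fun a ha ↦ hIG a ha g g.2)
  have ρc : ∀ g a, (ρ g a : L) = br a g := fun _ _ ↦ rfl
  have σc : ∀ g a, (σ g a : L) = br a g := fun _ _ ↦ rfl
  set P := G.projectionOnto I hcompl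
  set Q := I.projectionOnto G hcompl.symm
  have hPQ : ∀ u, u = (P u : L) + Q u := fun u ↦
    (Submodule.projection_add_projection_eq_self hcompl u).symm
  have PG : ∀ g : G, P g = g := Submodule.projectionOnto_apply_left hcompl
  have QI : ∀ i : I, Q i = i := Submodule.projectionOnto_apply_left hcompl.symm
  have PI : ∀ i : I, P i = 0 := Submodule.projectionOnto_apply_right hcompl
  have QG : ∀ g : G, Q g = 0 := Submodule.projectionOnto_apply_right hcompl.symm
  have brG : ∀ u v, br u v = br u (P v) := fun u v ↦ by
    conv_lhs => rw [hPQ v]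
    rw [map_add, hI _ _ (Q v).2, add_zero]
  have brc : ∀ u (x : G), br u x = (ρ x (P u) : L) + σ x (Q u) := fun u x ↦ by
    conv_lhs => rw [hPQ u]
    rw [map_add, LinearMap.add_apply, ρc, σc]
  have Pbr : ∀ u (x : G), P (br u x) = ρ x (P u) := fun u x ↦ by
    rw [brc, map_add, PG, PI, add_zero]
  have Qbr : ∀ u (x : G), Q (br u x) = σ x (Q u) := fun u x ↦ by
    rw [brc, map_add, QG, QI, zero_add]
  have hd' : ∀ u (x : G), d (br u x) = br (d u) x + br u (P (d x)) := fun u x ↦ by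
    rw [hd, brG u (d x)]
  have hPd : ∀ u (x : G), P (d (br u x)) = ρ x (P (d u)) + ρ (P (d x)) (P u) := fun u x ↦ by
    rw [hd', map_add, Pbr, Pbr]
  have hQd : ∀ u (x : G), Q (d (br u x)) = σ x (Q (d u)) + σ (P (d x)) (Q u) := fun u x ↦ by
    rw [hd', map_add, Qbr, Qbr]
  have hφ : P ∘ₗ d ∘ₗ I.subtype = 0 :=
    intertwiner_eq_zero_of_finrank_ne σ ρ irrI irrG hdim.symm _ fun g m ↦ by
      change P (d (σ g m)) = ρ g (P (d m))
      rw [σc, hPd, PI, map_zero, add_zero]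
  have hψ : Q ∘ₗ d ∘ₗ G.subtype = 0 :=
    intertwiner_eq_zero_of_finrank_ne ρ σ irrG irrI hdim _ fun g m ↦ by
      change Q (d (ρ g m)) = σ g (Q (d m))
      rw [ρc, hQd, QG, map_zero, add_zero]
  let b : G →ₗ[K] G →ₗ[K] G := LinearMap.mk₂ K (fun x y ↦ ρ y x)
    (fun _ _ _ ↦ map_add _ _ _) (fun _ _ _ ↦ map_smul _ _ _)
    (fun x y z ↦ Subtype.ext (map_add (br x) _ _)) (fun c x y ↦ Subtype.ext (map_smul (br x) _ _))
  obtain ⟨a, ha⟩ : ∃ a, ∀ x : G, P (d x) = ρ a x := by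
    refine exists_inner_of_simple b (fun x ↦ Subtype.ext (hGlie x x.2))
      (fun x y z ↦ Subtype.ext (leib x y z)) (fun J hJ ↦ irrG J hJ) ?_
      (P ∘ₗ d ∘ₗ G.subtype) (fun x y ↦ ?_)
    · obtain ⟨x, hx, y, hy, hxy⟩ := hGnonab
      exact ⟨⟨x, hx⟩, ⟨y, hy⟩, fun h ↦ hxy (congrArg Subtype.val h)⟩
    · change P (d (ρ y x)) = ρ y (P (d x)) + ρ (P (d y)) x
      rw [ρc, hPd, PG]
  have : Nontrivial I := Submodule.nontrivial_iff_ne_bot.mpr hIne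
  obtain ⟨c, hc⟩ := exists_eq_smul_of_commute_irreducible σ irrI (Q ∘ₗ d ∘ₗ I.subtype - σ a)
    (fun x i ↦ by
      change Q (d (σ x i)) - σ a (σ x i) = σ x (Q (d i) - σ a i)
      have h : σ (ρ a x) i = σ a (σ x i) - σ x (σ a i) := Subtype.ext (leib i x a)
      rw [σc, hQd, QI, ha, h, map_sub]
      abel)
  refine ⟨a, a.2, c, fun u ↦ ?_⟩
  have h1 : P (d (Q u)) = 0 := LinearMap.congr_fun hφ (Q u)
  have h2 : Q (d (P u)) = 0 := LinearMap.congr_fun hψ (P u)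
  have h3 : Q (d (Q u)) = σ a (Q u) + c • Q u := by
    rw [← hc (Q u)]
    change _ = σ a (Q u) + (Q (d (Q u)) - σ a (Q u))
    abel
  have hu : d u = d (P u) + d (Q u) := by rw [← map_add, ← hPQ]
  rw [hu, hPQ (d (P u)), hPQ (d (Q u)), h1, h2, h3, ha, brc u a]
  push_cast
  abel

/-- For a complex simple Leibniz algebra `L = G ∔ I` with `dim G ≠ dim I`, the space
of Leibniz 2-coboundaries `BL²(L,L)` has dimension `(dim G + dim I)² - dim G - 1`. -/
theorem stmt14 {L : Type*} [AddCommGroup L] [Module ℂ L] [FiniteDimensional ℂ L]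
    (br : L →ₗ[ℂ] L →ₗ[ℂ] L)
    (leib : ∀ x y z : L, br x (br y z) = br (br x y) z - br (br x z) y)
    (G I : Submodule ℂ L) (hcompl : IsCompl G I)
    (hGG : ∀ a ∈ G, ∀ b ∈ G, br a b ∈ G)
    (hIG : ∀ a ∈ I, ∀ b ∈ G, br a b ∈ I)
    -- `[G,I] = 0` and `[I,I] = 0`
    (hGI : ∀ a ∈ G, ∀ b ∈ I, br a b = 0)
    (hII : ∀ a ∈ I, ∀ b ∈ I, br a b = 0)
    -- `G` is a simple (non-abelian) Lie algebra
    (hGlie : ∀ a ∈ G, br a a = 0)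
    (hGsimple : ∀ J : Submodule ℂ L, J ≤ G →
      (∀ a ∈ J, ∀ g ∈ G, br a g ∈ J ∧ br g a ∈ J) → J = ⊥ ∨ J = G)
    (hGnonab : ∃ a ∈ G, ∃ b ∈ G, br a b ≠ 0)
    -- `I` is an irreducible (nonzero) right `G`-module
    (hIirr : ∀ J : Submodule ℂ L, J ≤ I →
      (∀ a ∈ J, ∀ g ∈ G, br a g ∈ J) → J = ⊥ ∨ J = I)
    (hIne : I ≠ ⊥)
    -- `dim G ≠ dim I`
    (hdim : Module.finrank ℂ ↥G ≠ Module.finrank ℂ ↥I)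
    :
    Module.finrank ℂ
        ↥(Submodule.span ℂ {f : L →ₗ[ℂ] L →ₗ[ℂ] L | ∃ d : L →ₗ[ℂ] L,
          ∀ x y : L, f x y = br (d x) y + br x (d y) - d (br x y)}) =
      (Module.finrank ℂ ↥G + Module.finrank ℂ ↥I) ^ 2 - Module.finrank ℂ ↥G - 1 := by
  have hI : ∀ a, ∀ b ∈ I, br a b = 0 := fun u b hb ↦ by
    obtain ⟨g, hg, i, hi, rfl⟩ := Submodule.mem_sup.mp (hcompl.sup_eq_top ▸ Submodule.mem_top (x := u))
    rw [map_add, LinearMap.add_apply, hGI g hg b hb, hII i hi b hb, add_zero]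
  have skew : ∀ x ∈ G, ∀ y ∈ G, br x y = -br y x := fun x hx y hy ↦ by
    have h := hGlie (x + y) (add_mem hx hy)
    simp only [map_add, LinearMap.add_apply, hGlie x hx, hGlie y hy, zero_add, add_zero] at h
    exact eq_neg_of_add_eq_zero_right h
  have hGsimple' : ∀ J : Submodule ℂ L, J ≤ G → (∀ a ∈ J, ∀ g ∈ G, br a g ∈ J) →
      J = ⊥ ∨ J = G := fun J hJ h ↦ hGsimple J hJ fun a ha g hg ↦
    ⟨h a ha g hg, by rw [skew g hg a (hJ ha)]; exact neg_mem (h a ha g hg)⟩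
  set P : L →ₗ[ℂ] L := I.subtype ∘ₗ I.projectionOnto G hcompl.symm
  have PI : ∀ i ∈ I, P i = i := fun i hi ↦
    congrArg Subtype.val (Submodule.projectionOnto_apply_left hcompl.symm ⟨i, hi⟩)
  have PG : ∀ g ∈ G, P g = 0 := fun g hg ↦
    congrArg Subtype.val (Submodule.projectionOnto_apply_right hcompl.symm ⟨g, hg⟩)
  have hmem : ∀ u, P u ∈ I := fun u ↦ Subtype.property _
  have hset : {f : L →ₗ[ℂ] L →ₗ[ℂ] L | ∃ d : L →ₗ[ℂ] L,
      ∀ x y : L, f x y = br (d x) y + br x (d y) - d (br x y)} =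
      (LinearMap.range (leibnizCoboundary br) : Set (L →ₗ[ℂ] L →ₗ[ℂ] L)) := by
    ext f
    refine exists_congr fun d ↦ ⟨fun h ↦ ?_, ?_⟩
    · ext x y
      rw [leibnizCoboundary_apply, h]
    · rintro rfl x y
      rfl
  have hker : LinearMap.ker (leibnizCoboundary br) =
      LinearMap.range (rightMulAddSMul br G P) := by
    ext d
    constructor
    · intro hd
      obtain ⟨a, ha, c, h⟩ := exists_derivation_eq br leib G I hcompl hGG hIG hI hGlie hGsimple'
        hGnonab hIirr hIne hdim d fun x y ↦
          (sub_eq_zero.mp (LinearMap.congr_fun₂ (LinearMap.mem_ker.mp hd) x y)).symm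
      refine ⟨(⟨a, ha⟩, c), LinearMap.ext fun u ↦ ?_⟩
      rw [rightMulAddSMul_apply, h]
      rfl
    · rintro ⟨⟨⟨a, ha⟩, c⟩, rfl⟩
      rw [LinearMap.mem_ker]
      ext x y
      have hy : P (br x y) = br (P x) y := by
        have hy : ∀ g ∈ G, P (br x g) = br (P x) g := fun g hg ↦ by
          obtain ⟨u, hu, i, hi, rfl⟩ :=
            Submodule.mem_sup.mp (hcompl.sup_eq_top ▸ Submodule.mem_top (x := x))
          simp only [map_add, LinearMap.add_apply, PG u hu, PI i hi, PG _ (hGG u hu g hg),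
            PI _ (hIG i hi g hg), map_zero, LinearMap.zero_apply]
        obtain ⟨g, hg, i, hi, rfl⟩ :=
          Submodule.mem_sup.mp (hcompl.sup_eq_top ▸ Submodule.mem_top (x := y))
        simp only [map_add, hI _ i hi, add_zero, hy g hg]
      simp only [leibnizCoboundary_apply, rightMulAddSMul_apply, map_add, map_smul,
        LinearMap.add_apply, LinearMap.smul_apply, LinearMap.zero_apply, hy, hI x _ (hmem y),
        smul_zero, add_zero, leib x y a]
      abel
  have hinj : Function.Injective (rightMulAddSMul br G P) := by
    rw [injective_iff_map_eq_zero]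
    rintro ⟨⟨a, ha⟩, c⟩ h
    have h' : ∀ u, br u a + c • P u = 0 := fun u ↦ by
      rw [← rightMulAddSMul_apply br G P (⟨a, ha⟩, c), h, LinearMap.zero_apply]
    have ha0 : a = 0 := by
      have hz : ∀ g ∈ G, br a g = 0 := fun g hg ↦ by
        have := h' g
        rw [PG g hg, smul_zero, add_zero] at this
        rw [skew a ha g hg, this, neg_zero]
      rcases hGsimple' (G ⊓ ⨅ g : G, LinearMap.ker (br.flip g)) inf_le_left (by
        rintro x ⟨-, hx⟩ g hg
        have hx' : br x g = 0 := (Submodule.mem_iInf _).mp hx ⟨g, hg⟩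
        rw [hx']
        exact zero_mem _) with hJ | hJ
      · rw [← Submodule.mem_bot ℂ, ← hJ]
        exact ⟨ha, (Submodule.mem_iInf _).mpr fun g ↦ hz g g.2⟩
      · obtain ⟨x, hx, y, hy, hxy⟩ := hGnonab
        rw [← hJ] at hx
        exact absurd ((Submodule.mem_iInf _).mp hx.2 ⟨y, hy⟩) hxy
    obtain ⟨i, hi, hi0⟩ := Submodule.exists_mem_ne_zero_of_ne_bot hIne
    have hc := h' i
    rw [ha0, map_zero, zero_add, PI i hi] at hc
    have hc0 := (smul_eq_zero.mp hc).resolve_right hi0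
    subst ha0 hc0
    rfl
  have h1 := LinearMap.finrank_range_add_finrank_ker (leibnizCoboundary br)
  rw [hker, LinearMap.finrank_range_of_inj hinj, Module.finrank_prod, Module.finrank_self,
    Module.finrank_linearMap, ← Submodule.finrank_add_eq_of_isCompl hcompl, ← pow_two] at h1
  rw [hset, Submodule.span_eq]
  omega
end

section
/- For the simple Leibniz algebra L = sl_2 ∔ I of dimension m+4 (m ≥ 2, I the (m+1)-dimensional irreducible sl_2-module), the space Φ^0_{I,G} of degree-0 Leibniz 2-cocycles supported on I ⊗ G with values in I has dimension m^2 + 2m. -/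
open Finset

/-- Basis index type: `Sum.inl 0 = e`, `Sum.inl 1 = f`, `Sum.inl 2 = h`,
`Sum.inr k = x_k`. -/
abbrev BasisIdx (m : ℕ) : Type := Fin 3 ⊕ Fin (m + 1)

/-- The underlying vector space of the `(m+4)`-dimensional algebra. -/
def Lm (m : ℕ) : Type := BasisIdx m → ℂ

noncomputable instance (m : ℕ) : AddCommGroup (Lm m) := Pi.addCommGroup
noncomputable instance (m : ℕ) : Module ℂ (Lm m) := Pi.module _ _ _
instance (m : ℕ) : FiniteDimensional ℂ (Lm m) := Module.Finite.pi (ι := BasisIdx m)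

/-- The basis vectors. -/
noncomputable def bas (m : ℕ) (i : BasisIdx m) : Lm m := Pi.single i 1

/-- Structure constants of the simple Leibniz algebra with associated Lie algebra
`sl₂`:  `[x_k,e] = -k(m+1-k)x_{k-1}`, `[x_k,f] = x_{k+1}`, `[x_k,h] = (m-2k)x_k`,
`[e,h] = 2e = -[h,e]`, `[h,f] = 2f = -[f,h]`, `[e,f] = h = -[f,e]`,
all other products of basis vectors being zero. -/
noncomputable def sc (m : ℕ) : BasisIdx m → BasisIdx m → Lm m
  | Sum.inr k, Sum.inl ⟨0, _⟩ =>
      (-((k : ℂ) * ((m : ℂ) + 1 - (k : ℂ)))) •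
        bas m (Sum.inr ⟨(k : ℕ) - 1, Nat.lt_of_le_of_lt (Nat.sub_le _ _) k.isLt⟩)
  | Sum.inr k, Sum.inl ⟨1, _⟩ =>
      if h : (k : ℕ) < m then bas m (Sum.inr ⟨(k : ℕ) + 1, by omega⟩) else 0
  | Sum.inr k, Sum.inl ⟨2, _⟩ => ((m : ℂ) - 2 * (k : ℂ)) • bas m (Sum.inr k)
  | Sum.inl ⟨0, _⟩, Sum.inl ⟨2, _⟩ => (2 : ℂ) • bas m (Sum.inl 0)
  | Sum.inl ⟨2, _⟩, Sum.inl ⟨0, _⟩ => (-2 : ℂ) • bas m (Sum.inl 0)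
  | Sum.inl ⟨2, _⟩, Sum.inl ⟨1, _⟩ => (2 : ℂ) • bas m (Sum.inl 1)
  | Sum.inl ⟨1, _⟩, Sum.inl ⟨2, _⟩ => (-2 : ℂ) • bas m (Sum.inl 1)
  | Sum.inl ⟨0, _⟩, Sum.inl ⟨1, _⟩ => bas m (Sum.inl 2)
  | Sum.inl ⟨1, _⟩, Sum.inl ⟨0, _⟩ => -bas m (Sum.inl 2)
  | _, _ => 0

/-- The bilinear bracket of the algebra, extended from the structure constants. -/
noncomputable def br (m : ℕ) (x y : Lm m) : Lm m :=
  ∑ i : BasisIdx m, ∑ j : BasisIdx m, (x i * y j) • sc m i j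

section LeibnizCocycles

open Matrix

/-- Square matrices acting on the coordinates with respect to `x_0, …, x_m`. -/
abbrev IMat (m : ℕ) : Type := Matrix (Fin (m + 1)) (Fin (m + 1)) ℂ

/-- The matrix of right multiplication by `e` on the ideal. -/
def rightE (m : ℕ) : IMat m := fun i j =>
  if (j : ℕ) = i + 1 then -((j : ℂ) * ((m : ℂ) + 1 - (j : ℂ))) else 0

/-- The matrix of right multiplication by `f` on the ideal. -/
def rightF (m : ℕ) : IMat m := fun i j => if (i : ℕ) = j + 1 then 1 else 0

/-- The matrix of right multiplication by `h` on the ideal. -/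
def rightH (m : ℕ) : IMat m := Matrix.diagonal fun i => (m : ℂ) - 2 * (i : ℂ)

/-- Zero extension of a matrix to all pairs of natural numbers. -/
def zeroExt {m : ℕ} (T : IMat m) (i j : ℕ) : ℂ :=
  if h : i < m + 1 ∧ j < m + 1 then T ⟨i, h.1⟩ ⟨j, h.2⟩ else 0

variable {m : ℕ}

lemma zeroExt_coe (T : IMat m) (i j : Fin (m + 1)) : zeroExt T i j = T i j :=
  dif_pos ⟨i.isLt, j.isLt⟩

lemma rightE_mul_apply (T : IMat m) (i j : Fin (m + 1)) :
    (rightE m * T) i j = -(((i : ℂ) + 1) * ((m : ℂ) - i)) * zeroExt T (i + 1) j := by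
  rw [Matrix.mul_apply]
  by_cases h : (i : ℕ) + 1 < m + 1
  · rw [Finset.sum_eq_single (⟨i + 1, h⟩ : Fin (m + 1))]
    · simp only [rightE, zeroExt, h, j.isLt, and_self, dif_pos, if_true]
      push_cast
      ring
    · intro k _ hk
      have : (k : ℕ) ≠ i + 1 := fun h' => hk (Fin.ext h')
      simp [rightE, this]
    · simp
  · have hi : (i : ℕ) = m := by omega
    rw [Finset.sum_eq_zero]
    · simp [hi]
    · intro k _
      have : (k : ℕ) ≠ i + 1 := by omega
      simp [rightE, this]

lemma mul_rightE_apply (T : IMat m) (i j : Fin (m + 1)) :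
    (T * rightE m) i j = -((j : ℂ) * ((m : ℂ) + 1 - j)) * zeroExt T i (j - 1) := by
  rw [Matrix.mul_apply]
  by_cases h : (j : ℕ) = 0
  · rw [Finset.sum_eq_zero]
    · simp [h]
    · intro k _
      have : (j : ℕ) ≠ k + 1 := by omega
      simp [rightE, this]
  · rw [Finset.sum_eq_single (⟨j - 1, by omega⟩ : Fin (m + 1))]
    · have h1 : (j : ℕ) = j - 1 + 1 := by omega
      have h2 : (j : ℕ) - 1 < m + 1 := by omega
      simp only [rightE, zeroExt, i.isLt, h2, and_self, dif_pos, if_pos h1]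
      ring
    · intro k _ hk
      have : (j : ℕ) ≠ k + 1 := fun h' => hk (Fin.ext (by simp only; omega))
      simp [rightE, this]
    · simp

lemma mul_rightF_apply (T : IMat m) (i j : Fin (m + 1)) :
    (T * rightF m) i j = zeroExt T i (j + 1) := by
  rw [Matrix.mul_apply]
  by_cases h : (j : ℕ) + 1 < m + 1
  · rw [Finset.sum_eq_single (⟨j + 1, h⟩ : Fin (m + 1))]
    · simp only [rightF, zeroExt, i.isLt, h, and_self, dif_pos, if_true, mul_one]
    · intro k _ hk
      have : (k : ℕ) ≠ j + 1 := fun h' => hk (Fin.ext h')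
      simp [rightF, this]
    · simp
  · rw [Finset.sum_eq_zero]
    · simp only [zeroExt, h, and_false, dif_neg, not_false_eq_true]
    · intro k _
      have : (k : ℕ) ≠ j + 1 := by omega
      simp [rightF, this]

lemma rightH_commutator_apply (T : IMat m) (i j : Fin (m + 1)) :
    (rightH m * T - T * rightH m) i j = 2 * ((j : ℂ) - i) * T i j := by
  simp only [rightH, Matrix.sub_apply, Matrix.diagonal_mul, Matrix.mul_diagonal]
  ring

lemma rightH_eq : rightH m = rightF m * rightE m - rightE m * rightF m := by
  ext i j
  rw [Matrix.sub_apply, mul_rightE_apply, mul_rightF_apply]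
  simp only [zeroExt, rightE, rightF, rightH, Matrix.diagonal_apply, Fin.ext_iff]
  have hi := i.isLt
  have hj := j.isLt
  by_cases hij : (i : ℕ) = j
  · by_cases h0 : (j : ℕ) = 0 <;> by_cases h1 : (j : ℕ) = m
    · have : m = 0 := by omega
      simp [hij, h0, this]
    · have : 0 < m := by omega
      simp [hij, h0, this]
    · have h2 : (j : ℕ) - 1 < m + 1 := by omega
      have h3 : m = m - 1 + 1 := by omega
      simp [hij, h1]
      rw [if_pos h3]
      ring
    · have h2 : (j : ℕ) - 1 < m + 1 := by omega
      have h3 : (j : ℕ) = j - 1 + 1 := by omega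
      have h4 : (j : ℕ) < m := by omega
      simp [hij, h4.le, h4, ← h3]
      ring
  · have h1 : ¬ ((i : ℕ) = j - 1 + 1 ∧ (j : ℕ) ≠ 0) := by omega
    by_cases h0 : (j : ℕ) = 0
    · have h3 : ¬ ((i : ℕ) = 0) := by omega
      simp [h0, h3]
    · have h3 : ¬ ((i : ℕ) = j - 1 + 1) := by omega
      have h4 : ¬ ((j : ℕ) = i) := by omega
      simp [hij, h3, h4]

lemma two_smul_rightE : (2 : ℂ) • rightE m = rightH m * rightE m - rightE m * rightH m := by
  ext i j
  rw [rightH_commutator_apply]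
  by_cases h : (j : ℕ) = i + 1
  · simp [rightE, h]
  · simp [rightE, h]

lemma two_smul_rightF : (2 : ℂ) • rightF m = rightF m * rightH m - rightH m * rightF m := by
  ext i j
  rw [← neg_sub, Matrix.neg_apply, rightH_commutator_apply]
  by_cases h : (i : ℕ) = j + 1
  · simp [rightF, h]
  · simp [rightF, h]

/-- The cocycle equations for the values `A`, `B`, `C` at `e`, `f`, `h`. -/
structure IsMatCocycle (A B C : IMat m) : Prop where
  ef : C = (rightF m * A - A * rightF m) - (rightE m * B - B * rightE m)
  eh : (2 : ℂ) • A = (rightH m * A - A * rightH m) - (rightE m * C - C * rightE m)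
  hf : (2 : ℂ) • B = (rightF m * C - C * rightF m) - (rightH m * B - B * rightH m)

lemma isMatCocycle_commutator (T : IMat m) :
    IsMatCocycle (rightE m * T - T * rightE m) (rightF m * T - T * rightF m)
      (rightH m * T - T * rightH m) where
  ef := by rw [rightH_eq]; noncomm_ring
  eh := by
    rw [smul_sub, ← smul_mul_assoc, ← mul_smul_comm, two_smul_rightE]; noncomm_ring
  hf := by
    rw [smul_sub, ← smul_mul_assoc, ← mul_smul_comm, two_smul_rightF]; noncomm_ring

lemma IsMatCocycle.sub {A B C A' B' C' : IMat m} (h : IsMatCocycle A B C)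
    (h' : IsMatCocycle A' B' C') : IsMatCocycle (A - A') (B - B') (C - C') where
  ef := by
    conv_lhs => rw [h.ef, h'.ef]
    noncomm_ring
  eh := by rw [smul_sub, h.eh, h'.eh]; noncomm_ring
  hf := by rw [smul_sub, h.hf, h'.hf]; noncomm_ring

lemma coeff_ne_zero {i : ℕ} (hi : i < m) : -(((i : ℂ) + 1) * ((m : ℂ) - i)) ≠ 0 := by
  rw [neg_ne_zero]
  refine mul_ne_zero (by exact_mod_cast Nat.succ_ne_zero i) ?_
  rw [sub_ne_zero]
  exact_mod_cast hi.ne'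

lemma rightE_commutator_apply_succ (T : IMat m) {i : ℕ} (hi : i < m) :
    (rightE m * T - T * rightE m) ⟨i, by omega⟩ ⟨i + 1, by omega⟩ =
      -(((i : ℂ) + 1) * ((m : ℂ) - i)) * (zeroExt T (i + 1) (i + 1) - zeroExt T i i) := by
  rw [Matrix.sub_apply, rightE_mul_apply, mul_rightE_apply]
  simp only [Nat.add_sub_cancel]
  push_cast
  ring

lemma eq_smul_one_of_commute_rightE {T : IMat m} (hT : ∀ i j, i ≠ j → T i j = 0)
    (hE : rightE m * T - T * rightE m = 0) : T = T 0 0 • (1 : IMat m) := by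
  have key : ∀ i : ℕ, i ≤ m → zeroExt T i i = T 0 0 := by
    intro i
    induction i with
    | zero => intro _; simp [zeroExt]
    | succ i ih =>
      intro hi
      have h := rightE_commutator_apply_succ T (i := i) (by omega)
      rw [hE, Matrix.zero_apply, eq_comm, mul_eq_zero] at h
      rcases h with h | h
      · exact absurd h (coeff_ne_zero (by omega))
      · rw [sub_eq_zero.1 h, ih (by omega)]
  ext i j
  by_cases hij : i = j
  · subst hij
    have := key i (by omega)
    rw [zeroExt_coe] at this
    simp [this]
  · simp [hT i j hij, hij]

lemma apply_eq_zero_of_commute_rightH {T : IMat m} (hH : rightH m * T - T * rightH m = 0)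
    (i j : Fin (m + 1)) (hij : i ≠ j) : T i j = 0 := by
  have h := rightH_commutator_apply T i j
  rw [hH, Matrix.zero_apply, eq_comm, mul_eq_zero] at h
  refine h.resolve_left (mul_ne_zero two_ne_zero ?_)
  rw [sub_ne_zero]
  exact_mod_cast fun h' : (j : ℕ) = i => hij (Fin.ext h'.symm)

/-- A cocycle with diagonal value at `h` vanishes at `h`, and its values at `e` and `f` are
supported on the superdiagonal and the subdiagonal. -/
lemma IsMatCocycle.of_diagonal {A B C : IMat m} (h : IsMatCocycle A B C)
    (hC : ∀ i j, i ≠ j → C i j = 0) :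
    C = 0 ∧ (∀ i j : Fin (m + 1), (j : ℕ) ≠ i + 1 → A i j = 0) ∧
      ∀ i j : Fin (m + 1), (i : ℕ) ≠ j + 1 → B i j = 0 := by
  have hEC : rightE m * C - C * rightE m = 0 := by
    ext i j
    have h1 := congrFun (congrFun h.eh i) j
    rw [Matrix.sub_apply _ (rightE m * C - C * rightE m), rightH_commutator_apply] at h1
    by_cases hij : (j : ℕ) = i + 1
    · simp only [Matrix.smul_apply, smul_eq_mul, hij] at h1
      push_cast at h1
      rw [Matrix.zero_apply]
      linear_combination h1
    · have e1 : zeroExt C (i + 1) j = 0 := by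
        unfold zeroExt
        split_ifs with h'
        · exact hC _ _ fun h'' => hij (Fin.mk.inj_iff.1 h'').symm
        · rfl
      rw [Matrix.sub_apply, rightE_mul_apply, mul_rightE_apply, e1]
      by_cases hj : (j : ℕ) = 0
      · simp [hj]
      · have e2 : zeroExt C i (j - 1) = 0 := by
          unfold zeroExt
          split_ifs with h'
          · refine hC _ _ fun h'' => hij ?_
            have := Fin.ext_iff.1 h''
            simp only at this
            omega
          · rfl
        simp [e2]
  have hC1 := eq_smul_one_of_commute_rightE hC hEC
  have htr : C.trace = 0 := by
    rw [h.ef]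
    simp [Matrix.trace_sub, Matrix.trace_mul_comm (rightF m) A,
      Matrix.trace_mul_comm (rightE m) B]
  have hC0 : C = 0 := by
    rw [hC1, Matrix.trace_smul, Matrix.trace_one, smul_eq_mul, mul_eq_zero] at htr
    rcases htr with htr | htr
    · rw [hC1, htr, zero_smul]
    · simp only [Fintype.card_fin] at htr
      exact absurd htr (by exact_mod_cast Nat.succ_ne_zero m)
  refine ⟨hC0, fun i j hij => ?_, fun i j hij => ?_⟩
  · have h1 := congrFun (congrFun h.eh i) j
    rw [hEC, sub_zero, rightH_commutator_apply, Matrix.smul_apply, smul_eq_mul] at h1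
    have h2 : ((j : ℂ) - (i + 1)) * A i j = 0 := by linear_combination -h1 / 2
    refine (mul_eq_zero.1 h2).resolve_left ?_
    rw [sub_eq_zero]
    exact_mod_cast hij
  · have h1 := congrFun (congrFun h.hf i) j
    rw [hC0, mul_zero, zero_mul, sub_zero, zero_sub, Matrix.neg_apply,
      rightH_commutator_apply, Matrix.smul_apply, smul_eq_mul] at h1
    have h2 : ((i : ℂ) - (j + 1)) * B i j = 0 := by linear_combination -h1 / 2
    refine (mul_eq_zero.1 h2).resolve_left ?_
    rw [sub_eq_zero]
    exact_mod_cast hij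

lemma eq_zero_of_commute_rightE {B : IMat m}
    (hB : ∀ i j : Fin (m + 1), (i : ℕ) ≠ j + 1 → B i j = 0)
    (hE : rightE m * B - B * rightE m = 0) : B = 0 := by
  have key : ∀ i : ℕ, zeroExt B (i + 1) i = 0 := by
    intro i
    induction i with
    | zero =>
      by_cases hm : 0 < m
      · have h := congrFun (congrFun hE 0) 0
        rw [Matrix.sub_apply, rightE_mul_apply, mul_rightE_apply] at h
        simpa [hm.ne'] using h
      · simp [zeroExt, hm]
    | succ i ih =>
      by_cases hi : i + 1 < m
      · have h := congrFun (congrFun hE ⟨i + 1, by omega⟩) ⟨i + 1, by omega⟩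
        rw [Matrix.sub_apply, rightE_mul_apply, mul_rightE_apply] at h
        simp only [Nat.add_sub_cancel, ih, mul_zero, sub_zero, Matrix.zero_apply] at h
        exact (mul_eq_zero.1 h).resolve_left (coeff_ne_zero hi)
      · simp [zeroExt, hi]
  ext i j
  by_cases hij : (i : ℕ) = j + 1
  · rw [← zeroExt_coe B i j, hij, key, Matrix.zero_apply]
  · rw [hB i j hij, Matrix.zero_apply]

/-- Every matrix cocycle is a coboundary. -/
lemma IsMatCocycle.exists_commutator {A B C : IMat m} (h : IsMatCocycle A B C) :
    ∃ T : IMat m, A = rightE m * T - T * rightE m ∧ B = rightF m * T - T * rightF m ∧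
      C = rightH m * T - T * rightH m := by
  let S : IMat m := fun i j => C i j / (2 * ((j : ℂ) - i))
  have hS := h.sub (isMatCocycle_commutator S)
  obtain ⟨hC, hA, -⟩ := hS.of_diagonal (by
    intro i j hij
    rw [Matrix.sub_apply, rightH_commutator_apply]
    have : ((j : ℂ) - i) ≠ 0 := by
      rw [sub_ne_zero]
      exact_mod_cast fun h' : (j : ℕ) = i => hij (Fin.ext h'.symm)
    simp only [S]
    field_simp
    ring)
  let A' : IMat m := A - (rightE m * S - S * rightE m)
  let D : IMat m := Matrix.diagonal fun i =>
    ∑ k ∈ Finset.range i, zeroExt A' k (k + 1) / -(((k : ℂ) + 1) * ((m : ℂ) - k))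
  have hHD : rightH m * D - D * rightH m = 0 := by
    ext i j
    rw [rightH_commutator_apply]
    by_cases hij : i = j
    · simp [hij]
    · simp [D, hij]
  have hD := hS.sub (isMatCocycle_commutator D)
  obtain ⟨-, hA2, hB2⟩ := hD.of_diagonal (by intro i j _; simp [hC, hHD])
  have hA0 : A' - (rightE m * D - D * rightE m) = 0 := by
    ext i j
    by_cases hij : (j : ℕ) = i + 1
    · have hi : (i : ℕ) < m := by omega
      have hj : j = ⟨i + 1, by omega⟩ := Fin.ext hij
      rw [hj, Matrix.sub_apply, rightE_commutator_apply_succ D hi]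
      have e1 : zeroExt D (i + 1) (i + 1) - zeroExt D i i =
          zeroExt A' i (i + 1) / -(((i : ℂ) + 1) * ((m : ℂ) - i)) := by
        have h1 : (i : ℕ) + 1 < m + 1 := by omega
        simp only [zeroExt, h1, i.isLt, and_self, dif_pos, D, Matrix.diagonal_apply_eq,
          Finset.sum_range_succ]
        ring
      rw [e1, mul_div_cancel₀ _ (coeff_ne_zero hi)]
      have := zeroExt_coe A' i ⟨i + 1, by omega⟩
      simp only at this
      rw [this, sub_self, Matrix.zero_apply]
    · exact hA2 i j hij
  have hB0 := eq_zero_of_commute_rightE hB2 (by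
    have h1 := hD.ef
    rw [hC, hHD] at h1
    change _ = rightF m * (A' - _) - (A' - _) * _ - _ at h1
    rw [hA0] at h1
    rw [sub_self, mul_zero, zero_mul, sub_zero, zero_sub] at h1
    exact neg_eq_zero.1 h1.symm)
  refine ⟨S + D, ?_, ?_, ?_⟩
  · rw [← sub_eq_zero, ← hA0]; simp only [A']; noncomm_ring
  · rw [← sub_eq_zero, ← hB0]; noncomm_ring
  · have h1 := hD.of_diagonal (by intro i j _; simp [hC, hHD])
    rw [← sub_eq_zero, ← h1.1]; noncomm_ring

/-- The inclusion of the ideal, in coordinates. -/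
def inclI (m : ℕ) : (Fin (m + 1) → ℂ) →ₗ[ℂ] Lm m where
  toFun v := Sum.elim 0 v
  map_add' v w := by
    funext i
    rcases i with i | i
    · exact (add_zero (0 : ℂ)).symm
    · rfl
  map_smul' c v := by
    funext i
    rcases i with i | i
    · exact (mul_zero c).symm
    · rfl

/-- The coordinates along the ideal. -/
def projI (m : ℕ) : Lm m →ₗ[ℂ] (Fin (m + 1) → ℂ) where
  toFun x k := x (Sum.inr k)
  map_add' _ _ := rfl
  map_smul' _ _ := rfl

/-- The matrix of right multiplication by `y` on the ideal. -/
noncomputable def rightMul (m : ℕ) : Lm m →ₗ[ℂ] IMat m where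
  toFun y := y (Sum.inl 0) • rightE m + y (Sum.inl 1) • rightF m + y (Sum.inl 2) • rightH m
  map_add' y z := by
    have h : ∀ i, (y + z) i = y i + z i := fun _ => rfl
    simp only [h]; module
  map_smul' c y := by
    have h : ∀ i, (c • y) i = c * y i := fun _ => rfl
    simp only [h, RingHom.id_apply]; module

lemma rightMul_apply (y : Lm m) : rightMul m y =
    y (Sum.inl 0) • rightE m + y (Sum.inl 1) • rightF m + y (Sum.inl 2) • rightH m := rfl

@[simp] lemma inclI_inl (v : Fin (m + 1) → ℂ) (i : Fin 3) : inclI m v (Sum.inl i) = 0 := rfl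

@[simp] lemma inclI_inr (v : Fin (m + 1) → ℂ) (k : Fin (m + 1)) :
    inclI m v (Sum.inr k) = v k := rfl

@[simp] lemma projI_inclI (v : Fin (m + 1) → ℂ) : projI m (inclI m v) = v := rfl

@[simp] lemma rightMul_inclI (v : Fin (m + 1) → ℂ) : rightMul m (inclI m v) = 0 := by
  simp [rightMul_apply]

lemma sum_apply_Lm {ι : Type*} (s : Finset ι) (g : ι → Lm m) (c : BasisIdx m) :
    (∑ i ∈ s, g i) c = ∑ i ∈ s, g i c :=
  Finset.sum_apply c s g

lemma smul_apply_Lm (a : ℂ) (x : Lm m) (c : BasisIdx m) : (a • x) c = a * x c := rfl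

lemma neg_apply_Lm (x : Lm m) (c : BasisIdx m) : (-x) c = -x c := rfl

lemma zero_apply_Lm (c : BasisIdx m) : (0 : Lm m) c = 0 := rfl

lemma bas_apply (i c : BasisIdx m) : bas m i c = if c = i then 1 else 0 := by
  simp [bas, Pi.single_apply]

lemma br_apply (x y : Lm m) (c : BasisIdx m) :
    br m x y c = ∑ i, ∑ j, x i * y j * sc m i j c := by
  simp only [br, sum_apply_Lm, smul_apply_Lm]

lemma sc_inr (i : BasisIdx m) (k : Fin (m + 1)) : sc m i (Sum.inr k) = 0 := by
  rcases i with i | i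
  · fin_cases i <;> rfl
  · rfl

lemma sc_inr_zero (k i : Fin (m + 1)) :
    sc m (Sum.inr k) (Sum.inl 0) (Sum.inr i) = rightE m i k := by
  change ((-((k : ℂ) * ((m : ℂ) + 1 - (k : ℂ)))) •
    bas m (Sum.inr ⟨(k : ℕ) - 1, _⟩)) (Sum.inr i) = _
  rw [smul_apply_Lm, bas_apply]
  simp only [Sum.inr.injEq, Fin.ext_iff, rightE]
  by_cases hk : (k : ℕ) = 0
  · simp [hk]
  · by_cases h : (k : ℕ) = i + 1
    · simp [h]
    · have : ¬ ((i : ℕ) = k - 1) := by omega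
      simp [h, this]

lemma sc_inr_one (k i : Fin (m + 1)) :
    sc m (Sum.inr k) (Sum.inl 1) (Sum.inr i) = rightF m i k := by
  change (if h : (k : ℕ) < m then bas m (Sum.inr ⟨(k : ℕ) + 1, by omega⟩) else 0) (Sum.inr i) = _
  split_ifs with h
  · simp [bas_apply, rightF, Fin.ext_iff]
  · have : ¬ ((i : ℕ) = k + 1) := by omega
    simp [rightF, this, zero_apply_Lm]

lemma sc_inr_two (k i : Fin (m + 1)) :
    sc m (Sum.inr k) (Sum.inl 2) (Sum.inr i) = rightH m i k := by
  change (((m : ℂ) - 2 * (k : ℂ)) • bas m (Sum.inr k)) (Sum.inr i) = _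
  rw [smul_apply_Lm, bas_apply, rightH, Matrix.diagonal_apply]
  by_cases h : i = k <;> simp [h]

lemma sc_inr_inl_inl (k : Fin (m + 1)) (j c : Fin 3) :
    sc m (Sum.inr k) (Sum.inl j) (Sum.inl c) = 0 := by
  fin_cases j
  · change (_ • bas m (Sum.inr _)) (Sum.inl c) = _
    simp [smul_apply_Lm, bas_apply]
  · change (if h : (k : ℕ) < m then bas m (Sum.inr ⟨(k : ℕ) + 1, by omega⟩) else 0) (Sum.inl c) = _
    split_ifs with h <;> simp [bas_apply, zero_apply_Lm]
  · change (_ • bas m (Sum.inr _)) (Sum.inl c) = _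
    simp [smul_apply_Lm, bas_apply]

@[simp] lemma sc_e_e : sc m (Sum.inl 0) (Sum.inl 0) = 0 := rfl

@[simp] lemma sc_e_f : sc m (Sum.inl 0) (Sum.inl 1) = bas m (Sum.inl 2) := rfl

@[simp] lemma sc_e_h : sc m (Sum.inl 0) (Sum.inl 2) = (2 : ℂ) • bas m (Sum.inl 0) := rfl

@[simp] lemma sc_f_e : sc m (Sum.inl 1) (Sum.inl 0) = -bas m (Sum.inl 2) := rfl

@[simp] lemma sc_f_f : sc m (Sum.inl 1) (Sum.inl 1) = 0 := rfl

@[simp] lemma sc_f_h : sc m (Sum.inl 1) (Sum.inl 2) = (-2 : ℂ) • bas m (Sum.inl 1) := rfl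

@[simp] lemma sc_h_e : sc m (Sum.inl 2) (Sum.inl 0) = (-2 : ℂ) • bas m (Sum.inl 0) := rfl

@[simp] lemma sc_h_f : sc m (Sum.inl 2) (Sum.inl 1) = (2 : ℂ) • bas m (Sum.inl 1) := rfl

@[simp] lemma sc_h_h : sc m (Sum.inl 2) (Sum.inl 2) = 0 := rfl

lemma sc_inl_inl_inr (i j : Fin 3) (k : Fin (m + 1)) :
    sc m (Sum.inl i) (Sum.inl j) (Sum.inr k) = 0 := by
  fin_cases i <;> fin_cases j <;>
    simp [smul_apply_Lm, bas_apply, zero_apply_Lm, neg_apply_Lm]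

lemma projI_br (x y : Lm m) : projI m (br m x y) = rightMul m y *ᵥ projI m x := by
  funext i
  change br m x y (Sum.inr i) = ∑ k, rightMul m y i k * x (Sum.inr k)
  rw [br_apply, Fintype.sum_sum_type]
  simp only [Fintype.sum_sum_type, sc_inr, zero_apply_Lm, mul_zero, Finset.sum_const_zero,
    add_zero, sc_inl_inl_inr, zero_add, Fin.sum_univ_three, sc_inr_zero, sc_inr_one, sc_inr_two]
  refine Finset.sum_congr rfl fun k _ => ?_
  simp only [rightMul_apply, Matrix.add_apply, Matrix.smul_apply, smul_eq_mul]
  ring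

lemma br_inl (x y : Lm m) (c : Fin 3) : br m x y (Sum.inl c) =
    ∑ i : Fin 3, ∑ j : Fin 3,
      x (Sum.inl i) * y (Sum.inl j) * sc m (Sum.inl i) (Sum.inl j) (Sum.inl c) := by
  rw [br_apply, Fintype.sum_sum_type]
  simp [Fintype.sum_sum_type, sc_inr, zero_apply_Lm, sc_inr_inl_inl]

lemma br_e (x y : Lm m) : br m x y (Sum.inl 0) =
    2 * (x (Sum.inl 0) * y (Sum.inl 2) - x (Sum.inl 2) * y (Sum.inl 0)) := by
  rw [br_inl]
  simp [Fin.sum_univ_three, smul_apply_Lm, bas_apply, zero_apply_Lm, neg_apply_Lm]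
  ring

lemma br_f (x y : Lm m) : br m x y (Sum.inl 1) =
    2 * (x (Sum.inl 2) * y (Sum.inl 1) - x (Sum.inl 1) * y (Sum.inl 2)) := by
  rw [br_inl]
  simp [Fin.sum_univ_three, smul_apply_Lm, bas_apply, zero_apply_Lm, neg_apply_Lm]
  ring

lemma br_h (x y : Lm m) : br m x y (Sum.inl 2) =
    x (Sum.inl 0) * y (Sum.inl 1) - x (Sum.inl 1) * y (Sum.inl 0) := by
  rw [br_inl]
  simp [Fin.sum_univ_three, smul_apply_Lm, bas_apply, zero_apply_Lm, neg_apply_Lm]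
  ring

lemma Lm_ext {x y : Lm m} (h0 : x (Sum.inl 0) = y (Sum.inl 0))
    (h1 : x (Sum.inl 1) = y (Sum.inl 1)) (h2 : x (Sum.inl 2) = y (Sum.inl 2))
    (h : projI m x = projI m y) : x = y := by
  funext i
  rcases i with i | i
  · fin_cases i
    exacts [h0, h1, h2]
  · exact congrFun h i

lemma br_inclI_right (x : Lm m) (v : Fin (m + 1) → ℂ) : br m x (inclI m v) = 0 := by
  refine Lm_ext ?_ ?_ ?_ ?_
  · rw [br_e]; simp [zero_apply_Lm]
  · rw [br_f]; simp [zero_apply_Lm]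
  · rw [br_h]; simp [zero_apply_Lm]
  · simp [projI_br]

lemma br_inclI_left (v : Fin (m + 1) → ℂ) (y : Lm m) :
    br m (inclI m v) y = inclI m (rightMul m y *ᵥ v) := by
  refine Lm_ext ?_ ?_ ?_ ?_
  · rw [br_e]; simp
  · rw [br_f]; simp
  · rw [br_h]; simp
  · simp [projI_br]

lemma rightMul_br (y z : Lm m) : rightMul m (br m y z) =
    rightMul m z * rightMul m y - rightMul m y * rightMul m z := by
  have key : ∀ a b c : ℂ, (2 * a) • rightE m + (2 * b) • rightF m + c • rightH m =
      a • (rightH m * rightE m - rightE m * rightH m) +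
        b • (rightF m * rightH m - rightH m * rightF m) +
          c • (rightF m * rightE m - rightE m * rightF m) := by
    intro a b c
    rw [← two_smul_rightE, ← two_smul_rightF, ← rightH_eq]
    module
  rw [rightMul_apply (br m y z), br_e, br_f, br_h, key]
  simp only [rightMul_apply, add_mul, mul_add, smul_mul_smul_comm]
  module

lemma eq_add_inclI (x : Lm m) : x = x (Sum.inl 0) • bas m (Sum.inl 0) +
    x (Sum.inl 1) • bas m (Sum.inl 1) + x (Sum.inl 2) • bas m (Sum.inl 2) +
      inclI m (projI m x) := by
  have hadd : ∀ (y z : Lm m) i, (y + z) i = y i + z i := fun _ _ _ => rfl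
  refine Lm_ext ?_ ?_ ?_ ?_
  · simp [hadd, smul_apply_Lm, bas_apply]
  · simp [hadd, smul_apply_Lm, bas_apply]
  · simp [hadd, smul_apply_Lm, bas_apply]
  · funext k
    change x (Sum.inr k) = _
    simp only [projI, LinearMap.coe_mk, AddHom.coe_mk]
    simp [hadd, smul_apply_Lm, bas_apply]

lemma projI_bas_inl (i : Fin 3) : projI m (bas m (Sum.inl i)) = 0 := by
  funext k
  change bas m (Sum.inl i) (Sum.inr k) = 0
  simp [bas_apply]

lemma bas_inr (k : Fin (m + 1)) : bas m (Sum.inr k) = inclI m (Pi.single k 1) := by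
  funext c
  rcases c with c | c
  · simp [bas_apply]
  · simp [bas_apply, Pi.single_apply]

lemma projI_eq_zero_of_mem {a : Lm m}
    (ha : a ∈ Submodule.span ℂ (Set.range fun i : Fin 3 => bas m (Sum.inl i))) :
    projI m a = 0 := by
  have h : Submodule.span ℂ (Set.range fun i : Fin 3 => bas m (Sum.inl i)) ≤
      LinearMap.ker (projI m) := by
    rw [Submodule.span_le]
    rintro _ ⟨i, rfl⟩
    exact projI_bas_inl i
  exact h ha

lemma span_bas_inr :
    Submodule.span ℂ (Set.range fun k : Fin (m + 1) => bas m (Sum.inr k)) =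
      LinearMap.range (inclI m) := by
  have h : (fun k : Fin (m + 1) => bas m (Sum.inr k)) =
      inclI m ∘ fun k => Pi.single k 1 := funext bas_inr
  rw [h, Set.range_comp, ← Submodule.map_span, LinearMap.range_eq_map]
  congr 1
  have h2 := (Pi.basisFun ℂ (Fin (m + 1))).span_eq
  rwa [show ⇑(Pi.basisFun ℂ (Fin (m + 1))) = fun k => Pi.single k (1 : ℂ) from
    funext fun k => Pi.basisFun_apply _ _ _] at h2

/-- The coboundary of an endomorphism of the ideal. -/
noncomputable def coboundary (m : ℕ) : IMat m →ₗ[ℂ] Lm m →ₗ[ℂ] Lm m →ₗ[ℂ] Lm m where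
  toFun T := LinearMap.mk₂ ℂ
    (fun a b => inclI m ((rightMul m b * T - T * rightMul m b) *ᵥ projI m a))
    (fun a a' b => by simp only [map_add, Matrix.mulVec_add])
    (fun c a b => by simp only [map_smul, Matrix.mulVec_smul])
    (fun a b b' => by
      rw [← map_add, ← Matrix.add_mulVec, map_add]
      congr 2
      noncomm_ring)
    (fun c a b => by
      rw [← map_smul, ← Matrix.smul_mulVec, map_smul, smul_sub, smul_mul_assoc, mul_smul_comm])
  map_add' S T := by
    refine LinearMap.ext₂ fun a b => ?_
    simp only [LinearMap.mk₂_apply, LinearMap.add_apply]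
    rw [← map_add, ← Matrix.add_mulVec]
    congr 2
    noncomm_ring
  map_smul' c T := by
    refine LinearMap.ext₂ fun a b => ?_
    simp only [LinearMap.mk₂_apply, LinearMap.smul_apply, RingHom.id_apply]
    rw [← map_smul, ← Matrix.smul_mulVec, smul_sub, smul_mul_assoc, mul_smul_comm]

lemma coboundary_apply (T : IMat m) (a b : Lm m) : coboundary m T a b =
    inclI m ((rightMul m b * T - T * rightMul m b) *ᵥ projI m a) := rfl

lemma rightMul_bas_zero : rightMul m (bas m (Sum.inl 0)) = rightE m := by
  simp [rightMul_apply, bas_apply]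

lemma rightMul_bas_one : rightMul m (bas m (Sum.inl 1)) = rightF m := by
  simp [rightMul_apply, bas_apply]

lemma rightMul_bas_two : rightMul m (bas m (Sum.inl 2)) = rightH m := by
  simp [rightMul_apply, bas_apply]

lemma coboundary_cocycle (T : IMat m) (x y z : Lm m) :
    br m x (coboundary m T y z) - br m (coboundary m T x y) z + br m (coboundary m T x z) y +
      coboundary m T x (br m y z) - coboundary m T (br m x y) z +
        coboundary m T (br m x z) y = 0 := by
  simp only [coboundary_apply, br_inclI_right, br_inclI_left, projI_br, rightMul_br,
    Matrix.mulVec_mulVec, ← map_sub, ← map_add, ← Matrix.sub_mulVec, ← Matrix.add_mulVec,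
    zero_sub, ← map_neg, ← Matrix.neg_mulVec]
  convert map_zero (inclI m)
  convert Matrix.zero_mulVec (projI m x)
  noncomm_ring

lemma ker_coboundary : LinearMap.ker (coboundary m) = Submodule.span ℂ {(1 : IMat m)} := by
  ext T
  rw [LinearMap.mem_ker, Submodule.mem_span_singleton]
  constructor
  · intro hT
    have key : ∀ b : Lm m, rightMul m b * T - T * rightMul m b = 0 := by
      intro b
      refine Matrix.ext_of_mulVec_single fun k => ?_
      have h := congrArg (projI m)
        (LinearMap.congr_fun₂ hT (inclI m (Pi.single k 1)) b)
      rw [coboundary_apply, projI_inclI, projI_inclI] at h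
      rw [h, Matrix.zero_mulVec, LinearMap.zero_apply, LinearMap.zero_apply, map_zero]
    have hE := key (bas m (Sum.inl 0))
    have hH := key (bas m (Sum.inl 2))
    rw [rightMul_bas_zero] at hE
    rw [rightMul_bas_two] at hH
    exact ⟨_, (eq_smul_one_of_commute_rightE (apply_eq_zero_of_commute_rightH hH) hE).symm⟩
  · rintro ⟨c, rfl⟩
    refine LinearMap.ext₂ fun a b => ?_
    simp [coboundary_apply]

lemma finrank_range_coboundary :
    Module.finrank ℂ (LinearMap.range (coboundary m)) = m ^ 2 + 2 * m := by
  have h := LinearMap.finrank_range_add_finrank_ker (coboundary m)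
  rw [ker_coboundary, finrank_span_singleton one_ne_zero, Module.finrank_matrix] at h
  simp only [Fintype.card_fin, Module.finrank_self, mul_one] at h
  have : (m + 1) * (m + 1) = m ^ 2 + 2 * m + 1 := by ring
  omega

lemma br_bas_ef : br m (bas m (Sum.inl 0)) (bas m (Sum.inl 1)) = bas m (Sum.inl 2) := by
  refine Lm_ext ?_ ?_ ?_ ?_
  · rw [br_e]; simp [bas_apply]
  · rw [br_f]; simp [bas_apply]
  · rw [br_h]; simp [bas_apply]
  · simp [projI_br, projI_bas_inl]

lemma br_bas_eh :
    br m (bas m (Sum.inl 0)) (bas m (Sum.inl 2)) = (2 : ℂ) • bas m (Sum.inl 0) := by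
  refine Lm_ext ?_ ?_ ?_ ?_
  · rw [br_e]; simp [bas_apply, smul_apply_Lm]
  · rw [br_f]; simp [bas_apply, smul_apply_Lm]
  · rw [br_h]; simp [bas_apply, smul_apply_Lm]
  · simp [projI_br, projI_bas_inl]

lemma br_bas_hf :
    br m (bas m (Sum.inl 2)) (bas m (Sum.inl 1)) = (2 : ℂ) • bas m (Sum.inl 1) := by
  refine Lm_ext ?_ ?_ ?_ ?_
  · rw [br_e]; simp [bas_apply, smul_apply_Lm]
  · rw [br_f]; simp [bas_apply, smul_apply_Lm]
  · rw [br_h]; simp [bas_apply, smul_apply_Lm]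
  · simp [projI_br, projI_bas_inl]

/-- The matrix, on the ideal, of `φ (·, b)`. -/
noncomputable def valueMatrix (φ : Lm m →ₗ[ℂ] Lm m →ₗ[ℂ] Lm m) (b : Lm m) : IMat m :=
  LinearMap.toMatrix' (projI m ∘ₗ φ.flip b ∘ₗ inclI m)

lemma valueMatrix_mulVec (φ : Lm m →ₗ[ℂ] Lm m →ₗ[ℂ] Lm m) (b : Lm m) (v : Fin (m + 1) → ℂ) :
    valueMatrix φ b *ᵥ v = projI m (φ (inclI m v) b) := by
  rw [valueMatrix, LinearMap.toMatrix'_mulVec]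
  rfl

lemma valueMatrix_smul (φ : Lm m →ₗ[ℂ] Lm m →ₗ[ℂ] Lm m) (c : ℂ) (b : Lm m) :
    valueMatrix φ (c • b) = c • valueMatrix φ b := by
  refine Matrix.ext_of_mulVec_single fun k => ?_
  rw [Matrix.smul_mulVec]
  simp only [valueMatrix_mulVec, map_smul]

lemma valueMatrix_br {φ : Lm m →ₗ[ℂ] Lm m →ₗ[ℂ] Lm m}
    (hφ : ∀ x y z : Lm m, br m x (φ y z) - br m (φ x y) z + br m (φ x z) y +
      φ x (br m y z) - φ (br m x y) z + φ (br m x z) y = 0) {y z : Lm m} (hyz : φ y z = 0) :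
    valueMatrix φ (br m y z) =
      (rightMul m z * valueMatrix φ y - valueMatrix φ y * rightMul m z) -
        (rightMul m y * valueMatrix φ z - valueMatrix φ z * rightMul m y) := by
  refine Matrix.ext_of_mulVec_single fun k => ?_
  have h := congrArg (projI m) (hφ (inclI m (Pi.single k 1)) y z)
  simp only [hyz, map_add, map_sub, projI_br, br_inclI_left, map_zero, Matrix.zero_mulVec] at h
  simp only [Matrix.sub_mulVec, ← Matrix.mulVec_mulVec, valueMatrix_mulVec]
  rw [← sub_eq_zero, ← h]
  abel

lemma exists_eq_coboundary {φ : Lm m →ₗ[ℂ] Lm m →ₗ[ℂ] Lm m}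
    (hφ : ∀ x y z : Lm m, br m x (φ y z) - br m (φ x y) z + br m (φ x z) y +
      φ x (br m y z) - φ (br m x y) z + φ (br m x z) y = 0)
    (hG : ∀ i b, φ (bas m (Sum.inl i)) b = 0) (hI : ∀ a v, φ a (inclI m v) = 0)
    (hIG : ∀ v i, φ (inclI m v) (bas m (Sum.inl i)) ∈ LinearMap.range (inclI m)) :
    ∃ T, coboundary m T = φ := by
  have hcoc : IsMatCocycle (valueMatrix φ (bas m (Sum.inl 0)))
      (valueMatrix φ (bas m (Sum.inl 1))) (valueMatrix φ (bas m (Sum.inl 2))) := by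
    constructor
    · have h := valueMatrix_br hφ (hG 0 (bas m (Sum.inl 1)))
      rwa [br_bas_ef, rightMul_bas_zero, rightMul_bas_one] at h
    · have h := valueMatrix_br hφ (hG 0 (bas m (Sum.inl 2)))
      rwa [br_bas_eh, valueMatrix_smul, rightMul_bas_zero, rightMul_bas_two] at h
    · have h := valueMatrix_br hφ (hG 2 (bas m (Sum.inl 1)))
      rwa [br_bas_hf, valueMatrix_smul, rightMul_bas_two, rightMul_bas_one] at h
  obtain ⟨T, hA, hB, hC⟩ := hcoc.exists_commutator
  have hval : ∀ i v, φ (inclI m v) (bas m (Sum.inl i)) =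
      inclI m (valueMatrix φ (bas m (Sum.inl i)) *ᵥ v) := by
    intro i v
    obtain ⟨w, hw⟩ := hIG v i
    rw [valueMatrix_mulVec, ← hw, projI_inclI]
  refine ⟨T, LinearMap.ext₂ fun a b => ?_⟩
  have ha : φ a = φ (inclI m (projI m a)) := by
    refine LinearMap.ext fun c => ?_
    conv_lhs => rw [eq_add_inclI a]
    simp only [map_add, map_smul, LinearMap.add_apply, LinearMap.smul_apply, hG, smul_zero,
      zero_add]
  rw [ha, coboundary_apply]
  conv_rhs => rw [eq_add_inclI b]
  simp only [map_add, map_smul, hI, add_zero, hval]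
  rw [hA, hB, hC, rightMul_apply]
  simp only [← map_smul, ← map_add, ← Matrix.smul_mulVec, ← Matrix.add_mulVec]
  congr 2
  simp only [add_mul, mul_add, smul_mul_assoc, mul_smul_comm, smul_sub]
  abel

end LeibnizCocycles

/-- For the simple Leibniz algebra `L = sl₂ ∔ I` of Theorem 2.3 (`dim L = m+4`,
`m ≥ 2`), the space `Φ⁰_{I,G}` of degree-`0` Leibniz 2-cocycles supported on `I ⊗ G`
with values in `I` has dimension `m² + 2m`. -/
theorem stmt17 (m : ℕ) (hm : 2 ≤ m) :
    let G : Submodule ℂ (Lm m) :=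
      Submodule.span ℂ (Set.range fun i : Fin 3 => bas m (Sum.inl i))
    let I : Submodule ℂ (Lm m) :=
      Submodule.span ℂ (Set.range fun k : Fin (m + 1) => bas m (Sum.inr k))
    let ΦIG : Set (Lm m →ₗ[ℂ] Lm m →ₗ[ℂ] Lm m) := {φ |
      (∀ x y z : Lm m,
        br m x (φ y z) - br m (φ x y) z + br m (φ x z) y +
          φ x (br m y z) - φ (br m x y) z + φ (br m x z) y = 0) ∧
      (∀ a ∈ G, ∀ b : Lm m, φ a b = 0) ∧ (∀ a : Lm m, ∀ b ∈ I, φ a b = 0) ∧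
      (∀ a ∈ I, ∀ b ∈ G, φ a b ∈ I)}
    Module.finrank ℂ ↥(Submodule.span ℂ ΦIG) = m ^ 2 + 2 * m := by
  intro G I ΦIG
  have hrange : ΦIG = (LinearMap.range (coboundary m) : Set (Lm m →ₗ[ℂ] Lm m →ₗ[ℂ] Lm m)) := by
    ext φ
    constructor
    · rintro ⟨hφ, hG, hI, hIG⟩
      have hGm : ∀ i, bas m (Sum.inl i) ∈ G := fun i => Submodule.subset_span ⟨i, rfl⟩
      have hIm : ∀ v, inclI m v ∈ I := fun v => by
        change inclI m v ∈ Submodule.span ℂ _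
        rw [span_bas_inr]
        exact ⟨v, rfl⟩
      refine exists_eq_coboundary hφ (fun i => hG _ (hGm i)) (fun a v => hI a _ (hIm v))
        fun v i => ?_
      rw [← span_bas_inr]
      exact hIG _ (hIm v) _ (hGm i)
    · rintro ⟨T, rfl⟩
      refine ⟨coboundary_cocycle T, fun a ha b => ?_, fun a b hb => ?_, fun a _ b _ => ?_⟩
      · rw [coboundary_apply, projI_eq_zero_of_mem ha, Matrix.mulVec_zero, map_zero]
      · change b ∈ Submodule.span ℂ _ at hb
        rw [span_bas_inr] at hb
        obtain ⟨v, rfl⟩ := hb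
        simp [coboundary_apply]
      · change _ ∈ Submodule.span ℂ _
        rw [span_bas_inr]
        exact ⟨_, rfl⟩
  rw [hrange, Submodule.span_eq]
  exact finrank_range_coboundary
end
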